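/- Let d ≥ 3 be an integer, ζ ∈ {0,1}, and if ζ = 1 assume 3 ≤ d ≤ 5 and 1 + 4/(d−1) ≤ p ≤ 1 + 4/(d−2). Let u be a classical finite-energy solution of the Coulomb wave equation ∂ₜ²u − Δₓu + u/|x| + ζ|u|^{p−1}u = 0 on ℝ^d with conserved energy E. Then there exists a constant C depending only on d such that for all real numbers R ≥ T > 0, Σ_{k∈ℤ} ∫_{|x|≤R} e(x, kT) dx ≤ C · R · E / T, where e(x,t) := ½|∇ₓu|² + ½|∂ₜu|² + |u|²/(2|x|) + ζ|u|^{p+1}/(p+1). -/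

import Mathlib

open MeasureTheory Filter

/-- The Laplacian of `u : ℝ^d → ℝ`, as the sum of second derivatives in the
coordinate directions. -/
noncomputable def lap {d : ℕ} (u : EuclideanSpace ℝ (Fin d) → ℝ)
    (x : EuclideanSpace ℝ (Fin d)) : ℝ :=
  ∑ i : Fin d, iteratedFDeriv ℝ 2 u x ![EuclideanSpace.single i 1, EuclideanSpace.single i 1]

/-- The radial derivative `u_r(x) = (x/|x|) · ∇u(x)`. -/
noncomputable def rderiv {d : ℕ} (u : EuclideanSpace ℝ (Fin d) → ℝ)
    (x : EuclideanSpace ℝ (Fin d)) : ℝ :=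
  @inner ℝ _ _ (‖x‖⁻¹ • x) (gradient u x)

/-- The angular part `∇̸u = ∇u - u_r · x/|x|` of the gradient. -/
noncomputable def angGrad {d : ℕ} (u : EuclideanSpace ℝ (Fin d) → ℝ)
    (x : EuclideanSpace ℝ (Fin d)) : EuclideanSpace ℝ (Fin d) :=
  gradient u x - rderiv u x • (‖x‖⁻¹ • x)

/-- `λ = (d-1)(d-3)/4`. -/
noncomputable def lam (d : ℕ) : ℝ := ((d : ℝ) - 1) * ((d : ℝ) - 3) / 4

/-- The energy density
`e = ½|∇ₓu|² + ½|∂ₜu|² + u²/(2|x|) + ζ|u|^{p+1}/(p+1)` of the Coulomb wave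
equation `∂ₜ²u - Δu + u/|x| + ζ|u|^{p-1}u = 0`. -/
noncomputable def eDen {d : ℕ} (p ζ : ℝ) (u : EuclideanSpace ℝ (Fin d) → ℝ → ℝ)
    (x : EuclideanSpace ℝ (Fin d)) (t : ℝ) : ℝ :=
  (1 / 2) * ‖gradient (fun y => u y t) x‖ ^ 2 + (1 / 2) * (deriv (u x) t) ^ 2
    + (u x t) ^ 2 / (2 * ‖x‖) + ζ * |u x t| ^ (p + 1) / (p + 1)

/-- `u` is a classical finite-energy solution of the Coulomb wave equation
`∂ₜ²u - Δu + u/|x| + ζ|u|^{p-1}u = 0` with conserved energy `E`: it is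
continuous on `ℝ^d × ℝ`, `C²` on `(ℝ^d∖{0}) × ℝ`, solves the equation away
from `x = 0`, and its total energy equals `E` at every time. -/
def IsCoulombSolution {d : ℕ} (p ζ : ℝ)
    (u : EuclideanSpace ℝ (Fin d) → ℝ → ℝ) (E : ℝ) : Prop :=
  Continuous (fun q : EuclideanSpace ℝ (Fin d) × ℝ => u q.1 q.2) ∧
  ContDiffOn ℝ 2 (fun q : EuclideanSpace ℝ (Fin d) × ℝ => u q.1 q.2)
    ({(0 : EuclideanSpace ℝ (Fin d))}ᶜ ×ˢ Set.univ) ∧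
  (∀ x : EuclideanSpace ℝ (Fin d), x ≠ 0 → ∀ t : ℝ,
    deriv (deriv (u x)) t - lap (fun y => u y t) x + u x t / ‖x‖
      + ζ * |u x t| ^ (p - 1) * u x t = 0) ∧
  (∀ t : ℝ, Integrable (fun x => eDen p ζ u x t)) ∧
  (∀ t : ℝ, ∫ x, eDen p ζ u x t = E)

/-- The non-directional energy density
`e' = ½|∇̸u|² + (λ/2)u²/|x|² + u²/(2|x|) + ζ|u|^{p+1}/(p+1)`. -/
noncomputable def ePrime {d : ℕ} (p ζ : ℝ) (u : EuclideanSpace ℝ (Fin d) → ℝ → ℝ)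
    (x : EuclideanSpace ℝ (Fin d)) (t : ℝ) : ℝ :=
  (1 / 2) * ‖angGrad (fun y => u y t) x‖ ^ 2 + lam d / 2 * (u x t) ^ 2 / ‖x‖ ^ 2
    + (u x t) ^ 2 / (2 * ‖x‖) + ζ * |u x t| ^ (p + 1) / (p + 1)

/-- `L₊u = u_r + ((d-1)/2)·u/|x| + ∂ₜu`. -/
noncomputable def Lplus {d : ℕ} (u : EuclideanSpace ℝ (Fin d) → ℝ → ℝ)
    (x : EuclideanSpace ℝ (Fin d)) (t : ℝ) : ℝ :=
  rderiv (fun y => u y t) x + ((d : ℝ) - 1) / 2 * u x t / ‖x‖ + deriv (u x) t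

/-- The inward energy density `e₋ = ¼|L₊u|² + ½e'`. -/
noncomputable def eMinus {d : ℕ} (p ζ : ℝ) (u : EuclideanSpace ℝ (Fin d) → ℝ → ℝ)
    (x : EuclideanSpace ℝ (Fin d)) (t : ℝ) : ℝ :=
  (1 / 4) * (Lplus u x t) ^ 2 + (1 / 2) * ePrime p ζ u x t

/-- The Morawetz density
`M = ½|∇̸u|²/|x| + (λ/2)u²/|x|³ + ζ(d-1)(p-1)|u|^{p+1}/(4(p+1)|x|) + u²/(4|x|²)`. -/
noncomputable def Mden {d : ℕ} (p ζ : ℝ) (u : EuclideanSpace ℝ (Fin d) → ℝ → ℝ)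
    (x : EuclideanSpace ℝ (Fin d)) (t : ℝ) : ℝ :=
  (1 / 2) * ‖angGrad (fun y => u y t) x‖ ^ 2 / ‖x‖ + lam d / 2 * (u x t) ^ 2 / ‖x‖ ^ 3
    + ζ * ((d : ℝ) - 1) * (p - 1) * |u x t| ^ (p + 1) / (4 * (p + 1) * ‖x‖)
    + (u x t) ^ 2 / (4 * ‖x‖ ^ 2)

section Cutoff

open Set Topology

variable {V : Type*} [NormedAddCommGroup V]

lemma continuous_cutoff_mul {χ : V → ℝ} (hχ : Continuous χ) (h0 : (0 : V) ∉ tsupport χ)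
    {F : V × ℝ → ℝ} (hF : ContinuousOn F ({(0 : V)}ᶜ ×ˢ univ)) :
    Continuous fun q : V × ℝ => χ q.1 * F q := by
  rw [continuous_iff_continuousAt]
  rintro ⟨x, t⟩
  by_cases hx : x = 0
  · have h1 : (tsupport χ)ᶜ ∈ 𝓝 x :=
      (isClosed_tsupport χ).isOpen_compl.mem_nhds (by simpa [hx] using h0)
    have h2 : ∀ᶠ q : V × ℝ in 𝓝 (x, t), χ q.1 * F q = 0 := by
      filter_upwards [continuous_fst.continuousAt.preimage_mem_nhds h1] with q hq
      rw [image_eq_zero_of_notMem_tsupport hq, zero_mul]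
    exact (continuousAt_const (y := (0 : ℝ))).congr (h2.mono fun q hq => hq.symm)
  · have hm : ({(0 : V)}ᶜ ×ˢ univ : Set (V × ℝ)) ∈ 𝓝 (x, t) :=
      (isOpen_compl_singleton.prod isOpen_univ).mem_nhds ⟨hx, mem_univ t⟩
    exact (hχ.comp continuous_fst).continuousAt.mul (hF.continuousAt hm)

section Measure

variable [MeasurableSpace V] [BorelSpace V] (μ : Measure V)

lemma continuous_integral_of_compact_support [IsLocallyFiniteMeasure μ] {H : V × ℝ → ℝ}
    (hH : Continuous H) {K : Set V} (hK : IsCompact K) (hz : ∀ x ∉ K, ∀ t, H (x, t) = 0) :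
    Continuous fun t => ∫ x, H (x, t) ∂μ := by
  have h := continuous_parametric_integral_of_continuous (μ := μ)
    (f := fun (t : ℝ) (x : V) => H (x, t)) (hH.comp continuous_swap) hK
  refine h.congr fun t => ?_
  exact setIntegral_eq_integral_of_forall_compl_eq_zero fun x hx => hz x hx t

lemma integrable_of_compact_support [IsFiniteMeasureOnCompacts μ] {H : V × ℝ → ℝ}
    (hH : Continuous H) {K : Set V} (hK : IsCompact K) (hz : ∀ x ∉ K, ∀ t, H (x, t) = 0) (t : ℝ) :
    Integrable (fun x => H (x, t)) μ :=
  (hH.comp (by fun_prop : Continuous fun x : V => (x, t))).integrable_of_hasCompactSupport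
    (HasCompactSupport.intro hK fun x hx => hz x hx t)

end Measure

variable [NormedSpace ℝ V]

lemma contDiff_cutoff_mul {χ : V → ℝ} (hχ : ContDiff ℝ 1 χ) (h0 : (0 : V) ∉ tsupport χ)
    {F : V × ℝ → ℝ} (hF : ContDiffOn ℝ 1 F ({(0 : V)}ᶜ ×ˢ univ)) :
    ContDiff ℝ 1 fun q : V × ℝ => χ q.1 * F q := by
  rw [contDiff_iff_contDiffAt]
  rintro ⟨x, t⟩
  by_cases hx : x = 0
  · have h1 : (tsupport χ)ᶜ ∈ 𝓝 x :=
      (isClosed_tsupport χ).isOpen_compl.mem_nhds (by simpa [hx] using h0)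
    have h2 : ∀ᶠ q : V × ℝ in 𝓝 (x, t), χ q.1 * F q = 0 := by
      filter_upwards [continuous_fst.continuousAt.preimage_mem_nhds h1] with q hq
      rw [image_eq_zero_of_notMem_tsupport hq, zero_mul]
    exact (contDiffAt_const (c := (0 : ℝ))).congr_of_eventuallyEq h2
  · have hm : ({(0 : V)}ᶜ ×ˢ univ : Set (V × ℝ)) ∈ 𝓝 (x, t) :=
      (isOpen_compl_singleton.prod isOpen_univ).mem_nhds ⟨hx, mem_univ t⟩
    exact (hχ.comp contDiff_fst).contDiffAt.mul (hF.contDiffAt hm)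

lemma fderiv_eq_zero_of_compact_support {H : V × ℝ → ℝ} {K : Set V}
    (hK : IsCompact K) (hz : ∀ x ∉ K, ∀ t, H (x, t) = 0) (v : V × ℝ) :
    ∀ x ∉ K, ∀ t, fderiv ℝ H (x, t) v = 0 := by
  intro x hx t
  have h2 : H =ᶠ[𝓝 (x, t)] fun _ => 0 := by
    filter_upwards [continuous_fst.continuousAt.preimage_mem_nhds
      (hK.isClosed.isOpen_compl.mem_nhds hx)] with q hq
    exact hz q.1 hq q.2
  rw [h2.fderiv_eq]
  simp

variable [MeasurableSpace V] [BorelSpace V] (μ : Measure V) [μ.IsAddHaarMeasure]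

lemma hasDerivAt_integral_of_compact_support {H : V × ℝ → ℝ} (hH : ContDiff ℝ 1 H) {K : Set V}
    (hK : IsCompact K) (hz : ∀ x ∉ K, ∀ t, H (x, t) = 0) (t : ℝ) :
    HasDerivAt (fun s => ∫ x, H (x, s) ∂μ) (∫ x, fderiv ℝ H (x, t) (0, 1) ∂μ) t := by
  have hc : Continuous fun q => fderiv ℝ H q ((0 : V), (1 : ℝ)) :=
    (hH.continuous_fderiv one_ne_zero).clm_apply continuous_const
  obtain ⟨M, hM⟩ := (hK.prod (isCompact_Icc (a := t - 1) (b := t + 1))).exists_bound_of_continuousOn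
    hc.continuousOn
  refine (hasDerivAt_integral_of_dominated_loc_of_deriv_le (F := fun s x => H (x, s))
    (F' := fun s x => fderiv ℝ H (x, s) (0, 1)) (bound := K.indicator fun _ => M)
    (Icc_mem_nhds (by linarith : t - 1 < t) (by linarith : t < t + 1)) ?_ ?_ ?_ ?_ ?_ ?_).2
  · exact Eventually.of_forall fun s =>
      (integrable_of_compact_support μ hH.continuous hK hz s).aestronglyMeasurable
  · exact integrable_of_compact_support μ hH.continuous hK hz t
  · exact (integrable_of_compact_support μ hc hK
      (fderiv_eq_zero_of_compact_support hK hz _) t).aestronglyMeasurable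
  · refine Eventually.of_forall fun x s hs => ?_
    by_cases hx : x ∈ K
    · rw [indicator_of_mem hx]
      exact hM (x, s) ⟨hx, hs⟩
    · rw [indicator_of_notMem hx, fderiv_eq_zero_of_compact_support hK hz _ x hx s, norm_zero]
  · exact (integrable_indicator_iff hK.measurableSet).2
      (integrableOn_const hK.measure_lt_top.ne)
  · refine Eventually.of_forall fun x s _ => ?_
    have h1 := ((hH.differentiable one_ne_zero) (x, s)).hasFDerivAt
    exact h1.comp_hasDerivAt s ((hasDerivAt_const s x).prodMk (hasDerivAt_id s))

variable [FiniteDimensional ℝ V]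

lemma integral_fderiv_of_compact_support {H : V × ℝ → ℝ} (hH : ContDiff ℝ 1 H) {K : Set V}
    (hK : IsCompact K) (hz : ∀ x ∉ K, ∀ t, H (x, t) = 0) (v : V) (t : ℝ) :
    ∫ x, fderiv ℝ H (x, t) (v, 0) ∂μ = 0 := by
  have hc : Continuous fun q => fderiv ℝ H q (v, (0 : ℝ)) :=
    (hH.continuous_fderiv one_ne_zero).clm_apply continuous_const
  have hd : ∀ x : V, HasFDerivAt (fun y => H (y, t))
      ((fderiv ℝ H (x, t)).comp (ContinuousLinearMap.inl ℝ V ℝ)) x := fun x =>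
    ((hH.differentiable one_ne_zero) (x, t)).hasFDerivAt.comp x (hasFDerivAt_prodMk_left x t)
  have he : ∀ x : V, fderiv ℝ (fun y => H (y, t)) x v = fderiv ℝ H (x, t) (v, 0) := fun x => by
    rw [(hd x).fderiv]; rfl
  have h := integral_mul_fderiv_eq_neg_fderiv_mul_of_integrable (μ := μ) (𝕜 := ℝ)
    (f := fun _ : V => (1 : ℝ)) (g := fun y => H (y, t)) (v := v) (by simp)
    (by
      simp only [he, one_mul]
      exact integrable_of_compact_support μ hc hK (fderiv_eq_zero_of_compact_support hK hz _) t)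
    (by
      simp only [one_mul]
      exact integrable_of_compact_support μ hH.continuous hK hz t)
    (fun x _ => by fun_prop) (fun x _ => (hd x).differentiableAt)
  simpa [he] using h

end Cutoff

section Balance

open Set Topology

variable {d : ℕ}

/-- Balance law `∂ₜD + div J = S` tested against a cutoff vanishing near the origin. -/
lemma hasDerivAt_integral_of_balance {χ : EuclideanSpace ℝ (Fin d) → ℝ} (hχ : ContDiff ℝ 1 χ)
    (h0 : (0 : EuclideanSpace ℝ (Fin d)) ∉ tsupport χ) (hc : HasCompactSupport χ)
    {D : EuclideanSpace ℝ (Fin d) × ℝ → ℝ} {J : Fin d → EuclideanSpace ℝ (Fin d) × ℝ → ℝ}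
    (hD : ContDiffOn ℝ 1 D ({0}ᶜ ×ˢ univ)) (hJ : ∀ i, ContDiffOn ℝ 1 (J i) ({0}ᶜ ×ˢ univ))
    {S : EuclideanSpace ℝ (Fin d) → ℝ} (t : ℝ)
    (hS : ∀ x, x ≠ 0 → fderiv ℝ D (x, t) (0, 1)
      + ∑ i, fderiv ℝ (J i) (x, t) (EuclideanSpace.single i 1, 0) = S x) :
    Integrable (fun x => χ x * S x
      + ∑ i, fderiv ℝ χ x (EuclideanSpace.single i 1) * J i (x, t)) ∧
    HasDerivAt (fun s => ∫ x, χ x * D (x, s)) (∫ x, (χ x * S x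
      + ∑ i, fderiv ℝ χ x (EuclideanSpace.single i 1) * J i (x, t))) t := by
  have hz : ∀ F : EuclideanSpace ℝ (Fin d) × ℝ → ℝ, ∀ x ∉ tsupport χ, ∀ t, χ x * F (x, t) = 0 :=
    fun F x hx t => by rw [image_eq_zero_of_notMem_tsupport hx, zero_mul]
  have hK : IsCompact (tsupport χ) := hc
  have hHD := contDiff_cutoff_mul hχ h0 hD
  have hHJ := fun i => contDiff_cutoff_mul hχ h0 (hJ i)
  have hpt : ∀ x, χ x * S x + ∑ i, fderiv ℝ χ x (EuclideanSpace.single i 1) * J i (x, t)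
      = fderiv ℝ (fun q : EuclideanSpace ℝ (Fin d) × ℝ => χ q.1 * D q) (x, t) (0, 1)
        + ∑ i, fderiv ℝ (fun q : EuclideanSpace ℝ (Fin d) × ℝ => χ q.1 * J i q) (x, t)
          (EuclideanSpace.single i 1, 0) := by
    intro x
    by_cases hx : x ∈ tsupport χ
    · have hx0 : x ≠ 0 := fun h => h0 (h ▸ hx)
      have hm : ({(0 : EuclideanSpace ℝ (Fin d))}ᶜ ×ˢ univ : Set (_ × ℝ)) ∈ 𝓝 (x, t) :=
        (isOpen_compl_singleton.prod isOpen_univ).mem_nhds ⟨hx0, mem_univ t⟩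
      have hmul : ∀ F : EuclideanSpace ℝ (Fin d) × ℝ → ℝ, ContDiffOn ℝ 1 F ({0}ᶜ ×ˢ univ) →
          ∀ v : EuclideanSpace ℝ (Fin d) × ℝ,
          fderiv ℝ (fun q : EuclideanSpace ℝ (Fin d) × ℝ => χ q.1 * F q) (x, t) v
            = χ x * fderiv ℝ F (x, t) v + fderiv ℝ χ x v.1 * F (x, t) := by
        intro F hF v
        have h1 : HasFDerivAt (fun q : EuclideanSpace ℝ (Fin d) × ℝ => χ q.1)
            ((fderiv ℝ χ x).comp (ContinuousLinearMap.fst ℝ _ ℝ)) (x, t) :=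
          ((hχ.differentiable one_ne_zero) x).hasFDerivAt.comp (x, t) hasFDerivAt_fst
        have h2 := ((hF.contDiffAt hm).differentiableAt one_ne_zero).hasFDerivAt
        rw [(h1.fun_mul h2).fderiv]
        simp [mul_comm]
      rw [hmul D hD, ← hS x hx0, Finset.sum_congr rfl fun i _ => hmul (J i) (hJ i) _,
        Finset.sum_add_distrib, ← Finset.mul_sum]
      simp
      ring
    · rw [fderiv_eq_zero_of_compact_support hK (hz D) _ x hx t,
        Finset.sum_eq_zero fun i _ => fderiv_eq_zero_of_compact_support hK (hz (J i)) _ x hx t,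
        image_eq_zero_of_notMem_tsupport hx, Finset.sum_eq_zero]
      · simp
      · intro i _
        have : χ =ᶠ[𝓝 x] fun _ => 0 := notMem_tsupport_iff_eventuallyEq.1 hx
        rw [this.fderiv_eq]
        simp
  have hi1 : Integrable fun x =>
      fderiv ℝ (fun q : EuclideanSpace ℝ (Fin d) × ℝ => χ q.1 * D q) (x, t) (0, 1) :=
    integrable_of_compact_support volume
      ((hHD.continuous_fderiv one_ne_zero).clm_apply continuous_const) hK
      (fderiv_eq_zero_of_compact_support hK (hz D) _) t
  have hi2 : ∀ i, Integrable fun x =>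
      fderiv ℝ (fun q : EuclideanSpace ℝ (Fin d) × ℝ => χ q.1 * J i q) (x, t)
        (EuclideanSpace.single i 1, 0) := fun i =>
    integrable_of_compact_support volume
      (((hHJ i).continuous_fderiv one_ne_zero).clm_apply continuous_const) hK
      (fderiv_eq_zero_of_compact_support hK (hz (J i)) _) t
  simp only [hpt]
  refine ⟨hi1.add (integrable_finsetSum _ fun i _ => hi2 i), ?_⟩
  rw [integral_add hi1 (integrable_finsetSum _ fun i _ => hi2 i),
    integral_finsetSum _ fun i _ => hi2 i, Finset.sum_eq_zero fun i _ =>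
      integral_fderiv_of_compact_support volume (hHJ i) hK (hz (J i)) _ t, add_zero]
  exact hasDerivAt_integral_of_compact_support volume hHD hK (hz D) t

end Balance

section LogCutoff

open Set Topology

variable {V : Type*} [NormedAddCommGroup V]

/-- A bump equal to `1` on `e^{-(n+1)} ≤ |x| ≤ e^{n+1}` and vanishing outside
`e^{-2(n+1)} < |x| < e^{2(n+1)}`. -/
noncomputable def logCutoff (n : ℕ) (x : V) : ℝ :=
  open Classical in
  if x = 0 then 0
  else (⟨1, 2, one_pos, one_lt_two⟩ : ContDiffBump (0 : ℝ)) (Real.log ‖x‖ / (n + 1))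

lemma logCutoff_nonneg (n : ℕ) (x : V) : 0 ≤ logCutoff n x := by
  unfold logCutoff
  split_ifs
  · exact le_rfl
  · exact ContDiffBump.nonneg _

lemma logCutoff_le_one (n : ℕ) (x : V) : logCutoff n x ≤ 1 := by
  unfold logCutoff
  split_ifs
  · exact zero_le_one
  · exact ContDiffBump.le_one _

lemma logCutoff_eq_zero {n : ℕ} {x : V} (h : 2 * ((n : ℝ) + 1) ≤ |Real.log ‖x‖|) :
    logCutoff n x = 0 := by
  unfold logCutoff
  split_ifs
  · rfl
  · apply ContDiffBump.zero_of_le_dist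
    have hn : (0 : ℝ) < n + 1 := by positivity
    rw [dist_zero_right, Real.norm_eq_abs, abs_div, abs_of_pos hn, le_div_iff₀ hn]
    exact h

lemma support_logCutoff_subset (n : ℕ) : Function.support (logCutoff n : V → ℝ) ⊆
    {x | Real.exp (-(2 * (n + 1))) ≤ ‖x‖ ∧ ‖x‖ ≤ Real.exp (2 * (n + 1))} := by
  intro x hx
  have hx0 : x ≠ 0 := by
    rintro rfl
    simp [logCutoff] at hx
  have hx' : |Real.log ‖x‖| < 2 * ((n : ℝ) + 1) := by
    by_contra! h
    exact hx (logCutoff_eq_zero h)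
  have hpos := norm_pos_iff.2 hx0
  rw [abs_lt] at hx'
  exact ⟨((Real.lt_log_iff_exp_lt hpos).1 hx'.1).le, ((Real.log_lt_iff_lt_exp hpos).1 hx'.2).le⟩

lemma tsupport_logCutoff_subset (n : ℕ) : tsupport (logCutoff n : V → ℝ) ⊆
    {x | Real.exp (-(2 * (n + 1))) ≤ ‖x‖ ∧ ‖x‖ ≤ Real.exp (2 * (n + 1))} :=
  closure_minimal (support_logCutoff_subset n)
    ((isClosed_le continuous_const continuous_norm).inter
      (isClosed_le continuous_norm continuous_const))

lemma zero_notMem_tsupport_logCutoff (n : ℕ) : (0 : V) ∉ tsupport (logCutoff n : V → ℝ) := by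
  intro h
  have := (tsupport_logCutoff_subset n h).1
  rw [norm_zero] at this
  exact absurd this (not_le.2 (Real.exp_pos _))

lemma logCutoff_eventuallyEq (n : ℕ) {x : V} (hx : x ≠ 0) : (logCutoff n : V → ℝ) =ᶠ[𝓝 x]
    fun y => (⟨1, 2, one_pos, one_lt_two⟩ : ContDiffBump (0 : ℝ)) (Real.log ‖y‖ / (n + 1)) := by
  filter_upwards [isOpen_ne.mem_nhds hx] with y hy
  exact if_neg hy

lemma tendsto_logCutoff {x : V} (hx : x ≠ 0) :
    Tendsto (fun n => logCutoff n x) atTop (𝓝 1) := by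
  obtain ⟨N, hN⟩ := exists_nat_ge |Real.log ‖x‖|
  refine tendsto_const_nhds.congr' ?_
  filter_upwards [eventually_ge_atTop N] with n hn
  have hn' : (N : ℝ) ≤ n := by exact_mod_cast hn
  rw [logCutoff, if_neg hx]
  refine (ContDiffBump.one_of_mem_closedBall _ ?_).symm
  have hn0 : (0 : ℝ) < n + 1 := by positivity
  rw [mem_closedBall_zero_iff, Real.norm_eq_abs, abs_div, abs_of_pos hn0, div_le_one hn0]
  linarith

variable [InnerProductSpace ℝ V]

lemma hasCompactSupport_logCutoff [FiniteDimensional ℝ V] (n : ℕ) :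
    HasCompactSupport (logCutoff n : V → ℝ) := by
  have : ProperSpace V := FiniteDimensional.proper ℝ V
  refine HasCompactSupport.of_support_subset_isCompact (isCompact_closedBall (0 : V)
    (Real.exp (2 * (n + 1)))) fun x hx => ?_
  rw [mem_closedBall_zero_iff]
  exact (support_logCutoff_subset n hx).2

lemma contDiff_logCutoff (n : ℕ) : ContDiff ℝ 1 (logCutoff n : V → ℝ) := by
  rw [contDiff_iff_contDiffAt]
  intro x
  by_cases hx : x = 0
  · have h2 : (logCutoff n : V → ℝ) =ᶠ[𝓝 x] fun _ => 0 :=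
      notMem_tsupport_iff_eventuallyEq.1 (hx ▸ zero_notMem_tsupport_logCutoff n)
    exact (contDiffAt_const (c := (0 : ℝ))).congr_of_eventuallyEq h2
  · refine ContDiffAt.congr_of_eventuallyEq ?_ (logCutoff_eventuallyEq n hx)
    exact (ContDiffBump.contDiff _).contDiffAt.comp x
      (((contDiffAt_norm ℝ hx).log (norm_ne_zero_iff.2 hx)).div_const _)

/-- The logarithmic cutoffs are radial and their scale-invariant derivative is `O(1/n)`. -/
lemma exists_fderiv_logCutoff (V : Type*) [NormedAddCommGroup V] [InnerProductSpace ℝ V] :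
    ∃ C : ℝ, 0 ≤ C ∧ ∀ (n : ℕ) (x : V), x ≠ 0 → ∃ ω : ℝ, |ω| ≤ C / (n + 1) ∧
      ∀ v, fderiv ℝ (logCutoff n : V → ℝ) x v = ω * (inner ℝ x v / ‖x‖ ^ 2) := by
  set φ : ContDiffBump (0 : ℝ) := ⟨1, 2, one_pos, one_lt_two⟩ with hφ
  obtain ⟨C, hC⟩ := (φ.hasCompactSupport.deriv).exists_bound_of_continuous
    ((φ.contDiff (n := 1)).continuous_deriv le_rfl)
  refine ⟨C, (norm_nonneg _).trans (hC 0), fun n x hx => ?_⟩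
  have hn0 : (0 : ℝ) < n + 1 := by positivity
  refine ⟨deriv φ (Real.log ‖x‖ / (n + 1)) / (n + 1), ?_, fun v => ?_⟩
  · rw [abs_div, abs_of_pos hn0]
    gcongr
    exact hC _
  · rw [(logCutoff_eventuallyEq n hx).fderiv_eq]
    have h0 : HasDerivAt φ (deriv φ (Real.log ‖x‖ / (n + 1))) (Real.log ‖x‖ / (n + 1)) :=
      (((φ.contDiff (n := 1)).differentiable one_ne_zero) _).hasDerivAt
    have hx' : ‖x‖ ≠ 0 := norm_ne_zero_iff.2 hx
    have h1 : HasFDerivAt (fun y : V => ‖y‖) (‖x‖⁻¹ • innerSL ℝ x) x := by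
      have := (hasStrictFDerivAt_norm_sq x).hasFDerivAt.sqrt (pow_ne_zero 2 hx')
      simp only [Real.sqrt_sq (norm_nonneg _)] at this
      convert! this using 1
      ext v
      simp
      field_simp
    have h2 : HasFDerivAt (fun y : V => Real.log ‖y‖ / ((n : ℝ) + 1))
        (((n : ℝ) + 1)⁻¹ • (‖x‖⁻¹ • ‖x‖⁻¹ • innerSL ℝ x)) x := by
      simpa only [div_eq_inv_mul] using (h1.log hx').const_mul ((n : ℝ) + 1)⁻¹
    have h3 := h0.comp_hasFDerivAt x h2
    change fderiv ℝ (φ ∘ fun y : V => Real.log ‖y‖ / ((n : ℝ) + 1)) x v = _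
    rw [h3.fderiv]
    simp
    field_simp

end LogCutoff

section Weight

variable {V : Type*} [NormedAddCommGroup V]

/-- The weight `R / √(R² + |x|²)`. -/
noncomputable def radialWeight (R : ℝ) (x : V) : ℝ := R / √(R ^ 2 + ‖x‖ ^ 2)

lemma radialWeight_pos {R : ℝ} (hR : 0 < R) (x : V) : 0 < radialWeight R x := by
  unfold radialWeight; positivity

lemma radialWeight_sq_mul {R : ℝ} (hR : 0 < R) (x : V) :
    radialWeight R x ^ 2 * (R ^ 2 + ‖x‖ ^ 2) = R ^ 2 := by
  have h : 0 < R ^ 2 + ‖x‖ ^ 2 := by positivity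
  rw [radialWeight, div_pow, Real.sq_sqrt h.le]
  field_simp

lemma radialWeight_identity {R : ℝ} (hR : 0 < R) (x : V) :
    (R ^ 2)⁻¹ * ‖x‖ ^ 2 * radialWeight R x ^ 2 = 1 - radialWeight R x ^ 2 := by
  have := radialWeight_sq_mul hR x
  field_simp
  linarith

lemma radialWeight_le_one {R : ℝ} (hR : 0 < R) (x : V) : radialWeight R x ≤ 1 := by
  have h := radialWeight_sq_mul hR x
  have h2 : radialWeight R x ^ 2 ≤ 1 ^ 2 := by
    by_contra! h3
    nlinarith [mul_pos (sub_pos.2 h3) (pow_pos hR 2), sq_nonneg (radialWeight R x * ‖x‖)]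
  exact le_of_sq_le_sq h2 zero_le_one

lemma quarter_le_radialWeight_cube {R : ℝ} (hR : 0 < R) {x : V} (hx : ‖x‖ ≤ R) :
    1 / 4 ≤ radialWeight R x ^ 3 := by
  have h := radialWeight_sq_mul hR x
  have hp := radialWeight_pos hR x
  have h1 := radialWeight_le_one hR x
  have hxx : ‖x‖ ^ 2 ≤ R ^ 2 := by gcongr
  have h2 : 1 / 2 ≤ radialWeight R x ^ 2 := by
    by_contra! h3
    nlinarith [pow_pos hR 2, sq_nonneg (radialWeight R x)]
  nlinarith

variable [InnerProductSpace ℝ V]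

lemma hasFDerivAt_radialWeight {R : ℝ} (hR : 0 < R) (x : V) :
    HasFDerivAt (radialWeight R : V → ℝ)
      (-((R ^ 2)⁻¹ * radialWeight R x ^ 3) • innerSL ℝ x) x := by
  have hp : 0 < R ^ 2 + ‖x‖ ^ 2 := by positivity
  have hs : √(R ^ 2 + ‖x‖ ^ 2) ≠ 0 := (Real.sqrt_pos.2 hp).ne'
  have h1 := ((hasStrictFDerivAt_norm_sq x).hasFDerivAt.const_add (R ^ 2)).sqrt hp.ne'
  have h2 := ((hasDerivAt_inv hs).comp_hasFDerivAt x h1).const_mul R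
  have he : (radialWeight R : V → ℝ) = fun y =>
      R * ((fun s : ℝ => s⁻¹) ∘ fun y : V => √(R ^ 2 + ‖y‖ ^ 2)) y := by
    funext y
    simp [radialWeight, div_eq_mul_inv]
  rw [he]
  refine h2.congr_fderiv ?_
  ext v
  have hq := Real.sq_sqrt hp.le
  simp
  field_simp

lemma contDiff_radialWeight {R : ℝ} (hR : 0 < R) {n : WithTop ℕ∞} :
    ContDiff ℝ n (radialWeight R : V → ℝ) := by
  unfold radialWeight
  refine contDiff_const.div ((contDiff_const.add (contDiff_norm_sq ℝ)).sqrt fun x => ?_) fun x => ?_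
  · positivity
  · positivity

lemma hasFDerivAt_norm_inv {x : V} (hx : x ≠ 0) :
    HasFDerivAt (fun y : V => ‖y‖⁻¹) (-(‖x‖⁻¹ ^ 3) • innerSL ℝ x) x := by
  have hx' : ‖x‖ ≠ 0 := norm_ne_zero_iff.2 hx
  have h1 := (hasStrictFDerivAt_norm_sq x).hasFDerivAt.sqrt (pow_ne_zero 2 hx')
  simp only [Real.sqrt_sq (norm_nonneg _)] at h1
  refine ((hasDerivAt_inv hx').comp_hasFDerivAt x h1).congr_fderiv ?_
  ext v
  simp
  field_simp

end Weight

section LineDeriv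

variable {W : Type*} [NormedAddCommGroup W] [NormedSpace ℝ W] {F G : W → ℝ} {F' G' : ℝ} {q v : W}

lemma HasLineDerivAt.fun_mul (hF : HasLineDerivAt ℝ F F' q v) (hG : HasLineDerivAt ℝ G G' q v) :
    HasLineDerivAt ℝ (fun y => F y * G y) (F' * G q + F q * G') q v := by
  have h := HasDerivAt.fun_mul hF hG
  simpa [HasLineDerivAt] using h

lemma HasLineDerivAt.fun_add (hF : HasLineDerivAt ℝ F F' q v) (hG : HasLineDerivAt ℝ G G' q v) :
    HasLineDerivAt ℝ (fun y => F y + G y) (F' + G') q v :=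
  HasDerivAt.fun_add hF hG

lemma HasLineDerivAt.fun_sub (hF : HasLineDerivAt ℝ F F' q v) (hG : HasLineDerivAt ℝ G G' q v) :
    HasLineDerivAt ℝ (fun y => F y - G y) (F' - G') q v :=
  HasDerivAt.fun_sub hF hG

lemma HasLineDerivAt.const_mul (c : ℝ) (hF : HasLineDerivAt ℝ F F' q v) :
    HasLineDerivAt ℝ (fun y => c * F y) (c * F') q v :=
  HasDerivAt.const_mul c hF

lemma HasLineDerivAt.fun_pow (n : ℕ) (hF : HasLineDerivAt ℝ F F' q v) :
    HasLineDerivAt ℝ (fun y => F y ^ n) (n * F q ^ (n - 1) * F') q v := by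
  have h := HasDerivAt.fun_pow hF n
  simpa [HasLineDerivAt] using h

lemma HasLineDerivAt.fun_sum {ι : Type*} {s : Finset ι} {F : ι → W → ℝ} {F' : ι → ℝ}
    (hF : ∀ i ∈ s, HasLineDerivAt ℝ (F i) (F' i) q v) :
    HasLineDerivAt ℝ (fun y => ∑ i ∈ s, F i y) (∑ i ∈ s, F' i) q v :=
  HasDerivAt.fun_sum hF

lemma HasLineDerivAt.scomp {h : ℝ → ℝ} {h' : ℝ} (hh : HasDerivAt h h' (F q))
    (hF : HasLineDerivAt ℝ F F' q v) :
    HasLineDerivAt ℝ (fun y => h (F y)) (h' * F') q v := by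
  have hh' : HasDerivAt h h' (F (q + (0 : ℝ) • v)) := by simpa using hh
  exact HasDerivAt.comp (0 : ℝ) hh' hF

lemma HasLineDerivAt.fderiv_apply (hF : HasLineDerivAt ℝ F F' q v) (hd : DifferentiableAt ℝ F q) :
    fderiv ℝ F q v = F' :=
  (hd.hasFDerivAt.hasLineDerivAt v).unique hF

end LineDeriv

section Jets

open Set Topology

variable {d : ℕ}

/-- The partial derivative in the `i`-th space direction. -/
noncomputable def pX (i : Fin d) (U : EuclideanSpace ℝ (Fin d) × ℝ → ℝ)
    (q : EuclideanSpace ℝ (Fin d) × ℝ) : ℝ :=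
  fderiv ℝ U q (EuclideanSpace.single i 1, 0)

/-- The time derivative. -/
noncomputable def pT (U : EuclideanSpace ℝ (Fin d) × ℝ → ℝ)
    (q : EuclideanSpace ℝ (Fin d) × ℝ) : ℝ :=
  fderiv ℝ U q (0, 1)

/-- Space-time with the spatial origin removed. -/
def puncturedSpaceTime (d : ℕ) : Set (EuclideanSpace ℝ (Fin d) × ℝ) := {0}ᶜ ×ˢ univ

lemma isOpen_puncturedSpaceTime : IsOpen (puncturedSpaceTime d) :=
  isOpen_compl_singleton.prod isOpen_univ

lemma mk_mem_puncturedSpaceTime {x : EuclideanSpace ℝ (Fin d)} (hx : x ≠ 0) (t : ℝ) :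
    (x, t) ∈ puncturedSpaceTime d := ⟨hx, mem_univ t⟩

lemma puncturedSpaceTime_mem_nhds {x : EuclideanSpace ℝ (Fin d)} (hx : x ≠ 0) (t : ℝ) :
    puncturedSpaceTime d ∈ 𝓝 (x, t) :=
  isOpen_puncturedSpaceTime.mem_nhds (mk_mem_puncturedSpaceTime hx t)

variable {U : EuclideanSpace ℝ (Fin d) × ℝ → ℝ}

lemma contDiffOn_fderiv_apply (hU : ContDiffOn ℝ 2 U (puncturedSpaceTime d))
    (v : EuclideanSpace ℝ (Fin d) × ℝ) :
    ContDiffOn ℝ 1 (fun q => fderiv ℝ U q v) (puncturedSpaceTime d) :=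
  (hU.fderiv_of_isOpen isOpen_puncturedSpaceTime (by norm_num)).clm_apply contDiffOn_const

lemma contDiffOn_pX (hU : ContDiffOn ℝ 2 U (puncturedSpaceTime d)) (i : Fin d) :
    ContDiffOn ℝ 1 (pX i U) (puncturedSpaceTime d) := contDiffOn_fderiv_apply hU _

lemma contDiffOn_pT (hU : ContDiffOn ℝ 2 U (puncturedSpaceTime d)) :
    ContDiffOn ℝ 1 (pT U) (puncturedSpaceTime d) := contDiffOn_fderiv_apply hU _

lemma differentiableAt_of_contDiffOn {n : WithTop ℕ∞} (hn : n ≠ 0)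
    (hU : ContDiffOn ℝ n U (puncturedSpaceTime d)) {x : EuclideanSpace ℝ (Fin d)} (hx : x ≠ 0)
    (t : ℝ) : DifferentiableAt ℝ U (x, t) :=
  (hU.contDiffAt (puncturedSpaceTime_mem_nhds hx t)).differentiableAt hn

lemma hasLineDerivAt_pX {n : WithTop ℕ∞} (hn : n ≠ 0)
    (hU : ContDiffOn ℝ n U (puncturedSpaceTime d)) {x : EuclideanSpace ℝ (Fin d)} (hx : x ≠ 0)
    (t : ℝ) (i : Fin d) :
    HasLineDerivAt ℝ U (pX i U (x, t)) (x, t) (EuclideanSpace.single i 1, 0) :=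
  (differentiableAt_of_contDiffOn hn hU hx t).hasFDerivAt.hasLineDerivAt _

lemma hasLineDerivAt_pT {n : WithTop ℕ∞} (hn : n ≠ 0)
    (hU : ContDiffOn ℝ n U (puncturedSpaceTime d)) {x : EuclideanSpace ℝ (Fin d)} (hx : x ≠ 0)
    (t : ℝ) : HasLineDerivAt ℝ U (pT U (x, t)) (x, t) (0, 1) :=
  (differentiableAt_of_contDiffOn hn hU hx t).hasFDerivAt.hasLineDerivAt _

lemma fderiv_fderiv_apply (hU : ContDiffOn ℝ 2 U (puncturedSpaceTime d))
    {x : EuclideanSpace ℝ (Fin d)} (hx : x ≠ 0) (t : ℝ) (v w : EuclideanSpace ℝ (Fin d) × ℝ) :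
    fderiv ℝ (fun q => fderiv ℝ U q v) (x, t) w = fderiv ℝ (fderiv ℝ U) (x, t) w v := by
  have h : DifferentiableAt ℝ (fderiv ℝ U) (x, t) :=
    ((hU.fderiv_of_isOpen (m := 1) isOpen_puncturedSpaceTime (by norm_num)).contDiffAt
      (puncturedSpaceTime_mem_nhds hx t)).differentiableAt one_ne_zero
  rw [fderiv_clm_apply h (differentiableAt_const v)]
  simp

lemma fderiv_fderiv_comm (hU : ContDiffOn ℝ 2 U (puncturedSpaceTime d))
    {x : EuclideanSpace ℝ (Fin d)} (hx : x ≠ 0) (t : ℝ) (v w : EuclideanSpace ℝ (Fin d) × ℝ) :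
    fderiv ℝ (fun q => fderiv ℝ U q v) (x, t) w = fderiv ℝ (fun q => fderiv ℝ U q w) (x, t) v := by
  rw [fderiv_fderiv_apply hU hx, fderiv_fderiv_apply hU hx]
  exact (hU.contDiffAt (puncturedSpaceTime_mem_nhds hx t)).isSymmSndFDerivAt (by simp) w v

lemma pX_pX_comm (hU : ContDiffOn ℝ 2 U (puncturedSpaceTime d))
    {x : EuclideanSpace ℝ (Fin d)} (hx : x ≠ 0) (t : ℝ) (i j : Fin d) :
    pX i (pX j U) (x, t) = pX j (pX i U) (x, t) := fderiv_fderiv_comm hU hx t _ _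

lemma pX_pT_comm (hU : ContDiffOn ℝ 2 U (puncturedSpaceTime d))
    {x : EuclideanSpace ℝ (Fin d)} (hx : x ≠ 0) (t : ℝ) (i : Fin d) :
    pX i (pT U) (x, t) = pT (pX i U) (x, t) := fderiv_fderiv_comm hU hx t _ _

lemma hasLineDerivAt_coord (q : EuclideanSpace ℝ (Fin d) × ℝ) (i j : Fin d) :
    HasLineDerivAt ℝ (fun q : EuclideanSpace ℝ (Fin d) × ℝ => q.1 j) (if j = i then 1 else 0) q
      (EuclideanSpace.single i 1, 0) := by
  have h := (((EuclideanSpace.proj j : EuclideanSpace ℝ (Fin d) →L[ℝ] ℝ).comp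
    (ContinuousLinearMap.fst ℝ _ ℝ)).hasFDerivAt (x := q)).hasLineDerivAt
      (EuclideanSpace.single i (1 : ℝ), (0 : ℝ))
  refine h.congr_deriv ?_
  simp

lemma hasLineDerivAt_fst {h : EuclideanSpace ℝ (Fin d) → ℝ} {c : ℝ}
    {x : EuclideanSpace ℝ (Fin d)} (hh : HasFDerivAt h (c • innerSL ℝ x) x) (t : ℝ) (i : Fin d) :
    HasLineDerivAt ℝ (fun q : EuclideanSpace ℝ (Fin d) × ℝ => h q.1) (c * x i) (x, t)
      (EuclideanSpace.single i 1, 0) := by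
  have h1 := (HasFDerivAt.comp (x, t) (g := h) (f := Prod.fst) hh hasFDerivAt_fst).hasLineDerivAt
    (EuclideanSpace.single i (1 : ℝ), (0 : ℝ))
  refine h1.congr_deriv ?_
  simp [EuclideanSpace.inner_single_right]

lemma hasLineDerivAt_fst_time (h : EuclideanSpace ℝ (Fin d) → ℝ)
    (q : EuclideanSpace ℝ (Fin d) × ℝ) :
    HasLineDerivAt ℝ (fun q : EuclideanSpace ℝ (Fin d) × ℝ => h q.1) 0 q (0, 1) := by
  have h1 : HasDerivAt (fun _ : ℝ => h q.1) 0 0 := hasDerivAt_const _ _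
  simpa [HasLineDerivAt] using h1

lemma contDiffOn_norm_inv {n : WithTop ℕ∞} :
    ContDiffOn ℝ n (fun q : EuclideanSpace ℝ (Fin d) × ℝ => ‖q.1‖⁻¹) (puncturedSpaceTime d) := by
  have h : ContDiffOn ℝ n (fun q : EuclideanSpace ℝ (Fin d) × ℝ => ‖q.1‖) (puncturedSpaceTime d) :=
    contDiff_fst.contDiffOn.norm ℝ fun q hq => hq.1
  exact h.inv fun q hq => norm_ne_zero_iff.2 hq.1

lemma contDiff_coord {n : WithTop ℕ∞} (j : Fin d) :
    ContDiff ℝ n (fun q : EuclideanSpace ℝ (Fin d) × ℝ => q.1 j) :=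
  ((EuclideanSpace.proj j : EuclideanSpace ℝ (Fin d) →L[ℝ] ℝ).comp
    (ContinuousLinearMap.fst ℝ _ ℝ)).contDiff

lemma sum_coord_sq (x : EuclideanSpace ℝ (Fin d)) : ∑ i, x i * x i = ‖x‖ ^ 2 := by
  rw [EuclideanSpace.real_norm_sq_eq]
  exact Finset.sum_congr rfl fun i _ => (sq (x i)).symm

end Jets

section Solution

open Set Topology

/-- A solution, `C²` off the origin, of `∂ₜ²U - ΔU + U/|x| + g(U) = 0`, where the nonlinearity
`g = G'` has a nonnegative primitive `G`. -/
structure IsRegularSolution {d : ℕ} (G g : ℝ → ℝ) (U : EuclideanSpace ℝ (Fin d) × ℝ → ℝ) :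
    Prop where
  contDiffOn : ContDiffOn ℝ 2 U (puncturedSpaceTime d)
  hasDerivAt : ∀ s, HasDerivAt G (g s) s
  continuous : Continuous g
  nonneg : ∀ s, 0 ≤ G s
  equation : ∀ x, x ≠ 0 → ∀ t, pT (pT U) (x, t) - ∑ i, pX i (pX i U) (x, t)
    + U (x, t) * ‖x‖⁻¹ + g (U (x, t)) = 0

/-- The squared length of the spatial gradient. -/
noncomputable def gradSq {d : ℕ} (U : EuclideanSpace ℝ (Fin d) × ℝ → ℝ)
    (q : EuclideanSpace ℝ (Fin d) × ℝ) : ℝ := ∑ i, pX i U q * pX i U q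

/-- The derivative `x · ∇U`. -/
noncomputable def eulerDeriv {d : ℕ} (U : EuclideanSpace ℝ (Fin d) × ℝ → ℝ)
    (q : EuclideanSpace ℝ (Fin d) × ℝ) : ℝ := ∑ i, q.1 i * pX i U q

/-- The energy density. -/
noncomputable def energyDensity {d : ℕ} (G : ℝ → ℝ) (U : EuclideanSpace ℝ (Fin d) × ℝ → ℝ)
    (q : EuclideanSpace ℝ (Fin d) × ℝ) : ℝ :=
  1 / 2 * gradSq U q + 1 / 2 * pT U q ^ 2 + 1 / 2 * (U q ^ 2 * ‖q.1‖⁻¹) + G (U q)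

variable {d : ℕ} {G g : ℝ → ℝ} {U : EuclideanSpace ℝ (Fin d) × ℝ → ℝ}

lemma gradSq_nonneg (q : EuclideanSpace ℝ (Fin d) × ℝ) : 0 ≤ gradSq U q :=
  Finset.sum_nonneg fun _ _ => mul_self_nonneg _

lemma eulerDeriv_sq_le (q : EuclideanSpace ℝ (Fin d) × ℝ) :
    eulerDeriv U q ^ 2 ≤ ‖q.1‖ ^ 2 * gradSq U q := by
  have h := Finset.sum_mul_sq_le_sq_mul_sq Finset.univ (fun i => q.1 i) (fun i => pX i U q)
  rw [← sum_coord_sq, gradSq, eulerDeriv]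
  simpa only [sq] using h

lemma contDiffOn_gradSq (hU : ContDiffOn ℝ 2 U (puncturedSpaceTime d)) :
    ContDiffOn ℝ 1 (gradSq U) (puncturedSpaceTime d) :=
  ContDiffOn.sum fun i _ => (contDiffOn_pX hU i).mul (contDiffOn_pX hU i)

lemma contDiffOn_eulerDeriv (hU : ContDiffOn ℝ 2 U (puncturedSpaceTime d)) :
    ContDiffOn ℝ 1 (eulerDeriv U) (puncturedSpaceTime d) :=
  ContDiffOn.sum fun i _ => (contDiff_coord i).contDiffOn.mul (contDiffOn_pX hU i)

namespace IsRegularSolution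

lemma contDiffOn_one (h : IsRegularSolution G g U) : ContDiffOn ℝ 1 U (puncturedSpaceTime d) :=
  h.contDiffOn.of_le (by norm_num)

lemma contDiffOn_potential (h : IsRegularSolution G g U) :
    ContDiffOn ℝ 1 (fun q => G (U q)) (puncturedSpaceTime d) := by
  have hG : ContDiff ℝ 1 G := by
    rw [contDiff_one_iff_deriv]
    refine ⟨fun s => (h.hasDerivAt s).differentiableAt, ?_⟩
    rw [show deriv G = g from funext fun s => (h.hasDerivAt s).deriv]
    exact h.continuous
  exact hG.comp_contDiffOn h.contDiffOn_one

lemma contDiffOn_energyDensity (h : IsRegularSolution G g U) :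
    ContDiffOn ℝ 1 (energyDensity G U) (puncturedSpaceTime d) :=
  (((contDiffOn_const.mul (contDiffOn_gradSq h.contDiffOn)).add
    (contDiffOn_const.mul ((contDiffOn_pT h.contDiffOn).pow 2))).add
    (contDiffOn_const.mul ((h.contDiffOn_one.pow 2).mul contDiffOn_norm_inv))).add
    h.contDiffOn_potential

lemma energyDensity_nonneg (h : IsRegularSolution G g U) (q : EuclideanSpace ℝ (Fin d) × ℝ) :
    0 ≤ energyDensity G U q := by
  have h1 := gradSq_nonneg (U := U) q
  have h2 := h.nonneg (U q)
  unfold energyDensity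
  positivity

end IsRegularSolution

end Solution

section Balance

open Set Topology

variable {d : ℕ}

lemma ae_ne_zero [NeZero d] : ∀ᵐ x : EuclideanSpace ℝ (Fin d), x ≠ 0 := by
  have : Nontrivial (EuclideanSpace ℝ (Fin d)) := inferInstance
  exact Measure.ae_ne volume 0

lemma aestronglyMeasurable_slice [NeZero d] {F : EuclideanSpace ℝ (Fin d) × ℝ → ℝ}
    (hF : ContinuousOn F (puncturedSpaceTime d)) (t : ℝ) :
    AEStronglyMeasurable (fun x => F (x, t)) := by
  have h1 : ContinuousOn (fun x => F (x, t)) {(0 : EuclideanSpace ℝ (Fin d))}ᶜ :=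
    hF.comp (by fun_prop) fun x hx => mk_mem_puncturedSpaceTime hx t
  have h2 := h1.aestronglyMeasurable (μ := volume) (measurableSet_singleton _).compl
  rwa [Measure.restrict_eq_self_of_ae_mem (s := {0}ᶜ) ae_ne_zero] at h2

lemma integrable_slice [NeZero d] {F : EuclideanSpace ℝ (Fin d) × ℝ → ℝ}
    (hF : ContinuousOn F (puncturedSpaceTime d)) {t : ℝ} {K : EuclideanSpace ℝ (Fin d) → ℝ}
    (hK : Integrable K) (hb : ∀ x, x ≠ 0 → |F (x, t)| ≤ K x) :
    Integrable (fun x => F (x, t)) :=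
  hK.mono' (aestronglyMeasurable_slice hF t) (ae_ne_zero.mono fun x hx => hb x hx)

lemma abs_logCutoff_mul_le {V : Type*} [NormedAddCommGroup V] (n : ℕ) (x : V) {a b : ℝ}
    (h : |a| ≤ b) : |logCutoff n x * a| ≤ b := by
  rw [abs_mul, abs_of_nonneg (logCutoff_nonneg n x)]
  exact (mul_le_of_le_one_left (abs_nonneg _) (logCutoff_le_one n x)).trans h

lemma tendsto_integral_logCutoff_mul [NeZero d] {F : EuclideanSpace ℝ (Fin d) × ℝ → ℝ}
    (hF : ContinuousOn F (puncturedSpaceTime d)) {t : ℝ} {K : EuclideanSpace ℝ (Fin d) → ℝ}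
    (hK : Integrable K) (hb : ∀ x, x ≠ 0 → |F (x, t)| ≤ K x) :
    Tendsto (fun n => ∫ x, logCutoff n x * F (x, t)) atTop (𝓝 (∫ x, F (x, t))) := by
  refine tendsto_integral_filter_of_dominated_convergence K
    (Eventually.of_forall fun n => ?_) (Eventually.of_forall fun n => ?_) hK ?_
  · exact (contDiff_logCutoff n).continuous.aestronglyMeasurable.mul
      (aestronglyMeasurable_slice hF t)
  · filter_upwards [ae_ne_zero] with x hx
    exact abs_logCutoff_mul_le n x (hb x hx)
  · filter_upwards [ae_ne_zero] with x hx
    simpa using (tendsto_logCutoff hx).mul_const (F (x, t))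

lemma abs_integral_logCutoff_mul_le [NeZero d] {F : EuclideanSpace ℝ (Fin d) × ℝ → ℝ}
    {t : ℝ} {K : EuclideanSpace ℝ (Fin d) → ℝ}
    (hK : Integrable K) (hb : ∀ x, x ≠ 0 → |F (x, t)| ≤ K x) (n : ℕ) :
    |∫ x, logCutoff n x * F (x, t)| ≤ ∫ x, K x := by
  refine norm_integral_le_of_norm_le (f := fun x => logCutoff n x * F (x, t)) hK ?_
  filter_upwards [ae_ne_zero] with x hx
  exact abs_logCutoff_mul_le n x (hb x hx)

lemma continuous_integral_logCutoff_mul {F : EuclideanSpace ℝ (Fin d) × ℝ → ℝ}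
    (hF : ContinuousOn F (puncturedSpaceTime d)) (n : ℕ) :
    Continuous fun t => ∫ x, logCutoff n x * F (x, t) := by
  refine continuous_integral_of_compact_support volume (K := tsupport (logCutoff n))
    (H := fun q => logCutoff n q.1 * F q)
    (continuous_cutoff_mul (contDiff_logCutoff n).continuous (zero_notMem_tsupport_logCutoff n) hF)
    (hasCompactSupport_logCutoff n) fun x hx t => ?_
  rw [image_eq_zero_of_notMem_tsupport hx, zero_mul]

variable {K : EuclideanSpace ℝ (Fin d) × ℝ → ℝ} {k : ℝ}

lemma intervalIntegrable_integral [NeZero d] {F : EuclideanSpace ℝ (Fin d) × ℝ → ℝ}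
    (hF : ContinuousOn F (puncturedSpaceTime d)) (hK : ∀ t, Integrable fun x => K (x, t))
    (hk : ∀ t, ∫ x, K (x, t) ≤ k) (hb : ∀ x, x ≠ 0 → ∀ t, |F (x, t)| ≤ K (x, t)) (t₁ t₂ : ℝ) :
    IntervalIntegrable (fun t => ∫ x, F (x, t)) volume t₁ t₂ := by
  have hm : AEStronglyMeasurable (fun t => ∫ x, F (x, t)) (volume.restrict (uIoc t₁ t₂)) :=
    aestronglyMeasurable_of_tendsto_ae atTop
      (fun n => (continuous_integral_logCutoff_mul hF n).aestronglyMeasurable)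
      (Eventually.of_forall fun t => tendsto_integral_logCutoff_mul hF (hK t) fun x hx => hb x hx t)
  refine (intervalIntegrable_const (c := k)).mono_fun' hm (Eventually.of_forall fun t => ?_)
  refine (norm_integral_le_of_norm_le (hK t) ?_).trans (hk t)
  filter_upwards [ae_ne_zero] with x hx
  exact hb x hx t

/-- Integrated form of a differential inequality `∂ₜD + div J ≤ s` that holds away from the origin,
when the densities are dominated by an integrable majorant. -/
lemma integral_sub_le_of_balance [NeZero d] {D s : EuclideanSpace ℝ (Fin d) × ℝ → ℝ}
    {J : Fin d → EuclideanSpace ℝ (Fin d) × ℝ → ℝ}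
    (hD : ContDiffOn ℝ 1 D (puncturedSpaceTime d))
    (hJ : ∀ i, ContDiffOn ℝ 1 (J i) (puncturedSpaceTime d))
    (hs : ContinuousOn s (puncturedSpaceTime d))
    (hK : ∀ t, Integrable fun x => K (x, t)) (hk : ∀ t, ∫ x, K (x, t) ≤ k)
    (hDK : ∀ x, x ≠ 0 → ∀ t, |D (x, t)| ≤ K (x, t))
    (hJK : ∀ x, x ≠ 0 → ∀ t, |∑ i, x i * J i (x, t)| ≤ ‖x‖ ^ 2 * K (x, t))
    (hsK : ∀ x, x ≠ 0 → ∀ t, |s (x, t)| ≤ K (x, t))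
    (hle : ∀ x, x ≠ 0 → ∀ t, fderiv ℝ D (x, t) (0, 1)
      + ∑ i, fderiv ℝ (J i) (x, t) (EuclideanSpace.single i 1, 0) ≤ s (x, t))
    {t₁ t₂ : ℝ} (ht : t₁ ≤ t₂) :
    (∫ x, D (x, t₂)) - ∫ x, D (x, t₁) ≤ ∫ t in t₁..t₂, ∫ x, s (x, t) := by
  obtain ⟨C, hC0, hC⟩ := exists_fderiv_logCutoff (EuclideanSpace ℝ (Fin d))
  have hmain : ∀ n : ℕ, (∫ x, logCutoff n x * D (x, t₂)) - ∫ x, logCutoff n x * D (x, t₁)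
      ≤ ∫ t in t₁..t₂, ((∫ x, logCutoff n x * s (x, t)) + C / (n + 1) * k) := by
    intro n
    have hd := fun t => hasDerivAt_integral_of_balance (contDiff_logCutoff n)
      (zero_notMem_tsupport_logCutoff n) (hasCompactSupport_logCutoff n) hD hJ t
      (fun x _ => rfl)
    refine intervalIntegral.sub_le_integral_of_hasDeriv_right_of_le ht
      (fun t _ => (hd t).2.continuousAt.continuousWithinAt)
      (fun t _ => (hd t).2.hasDerivWithinAt) ?_ fun t _ => ?_
    · exact ((continuous_integral_logCutoff_mul hs n).add
        continuous_const).continuousOn.integrableOn_Icc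
    · have hsi : Integrable fun x => logCutoff n x * s (x, t) :=
        integrable_slice (F := fun q => logCutoff n q.1 * s q)
          (((contDiff_logCutoff n).continuous.comp continuous_fst).continuousOn.mul hs) (hK t)
          fun x hx => abs_logCutoff_mul_le n x (hsK x hx t)
      calc _ ≤ ∫ x, (logCutoff n x * s (x, t) + C / (n + 1) * K (x, t)) := by
            refine integral_mono_ae (hd t).1 (hsi.add ((hK t).const_mul _)) ?_
            filter_upwards [ae_ne_zero] with x hx
            obtain ⟨ω, hω, hω'⟩ := hC n x hx
            have hx2 : 0 < ‖x‖ ^ 2 := by positivity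
            have hsum : ∑ i, fderiv ℝ (logCutoff n) x (EuclideanSpace.single i 1) * J i (x, t)
                = ω * ((∑ i, x i * J i (x, t)) / ‖x‖ ^ 2) := by
              rw [Finset.sum_div, Finset.mul_sum]
              refine Finset.sum_congr rfl fun i _ => ?_
              rw [hω', EuclideanSpace.inner_single_right]
              simp
              ring
            refine add_le_add (mul_le_mul_of_nonneg_left (hle x hx t) (logCutoff_nonneg n x)) ?_
            rw [hsum]
            refine (le_abs_self _).trans ?_
            rw [abs_mul, abs_div, abs_of_pos hx2]
            refine mul_le_mul hω ((div_le_iff₀' hx2).2 (hJK x hx t)) (by positivity) (by positivity)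
        _ = (∫ x, logCutoff n x * s (x, t)) + C / (n + 1) * ∫ x, K (x, t) := by
            rw [integral_add hsi ((hK t).const_mul _), integral_const_mul]
        _ ≤ _ := by gcongr; exact hk t
  refine le_of_tendsto_of_tendsto' ((tendsto_integral_logCutoff_mul hD.continuousOn (hK t₂)
    fun x hx => hDK x hx t₂).sub (tendsto_integral_logCutoff_mul hD.continuousOn (hK t₁)
    fun x hx => hDK x hx t₁)) ?_ hmain
  have hCn : Tendsto (fun n : ℕ => C / ((n : ℝ) + 1) * k) atTop (𝓝 0) := by
    simpa [div_eq_mul_inv] using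
      ((tendsto_one_div_add_atTop_nhds_zero_nat (𝕜 := ℝ)).const_mul C).mul_const k
  have hk0 : 0 ≤ k := (abs_nonneg _).trans
    ((abs_integral_logCutoff_mul_le (hK t₁) (fun x hx => hsK x hx t₁) 0).trans (hk t₁))
  refine intervalIntegral.tendsto_integral_filter_of_dominated_convergence (fun _ => k + C * k)
    (Eventually.of_forall fun n => ((continuous_integral_logCutoff_mul hs n).add
      continuous_const).aestronglyMeasurable)
    (Eventually.of_forall fun n => Eventually.of_forall fun t _ => ?_)
    intervalIntegrable_const (Eventually.of_forall fun t _ => ?_)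
  · have hn : C / ((n : ℝ) + 1) ≤ C := div_le_self hC0 (by linarith [n.cast_nonneg (α := ℝ)])
    have hn0 : 0 ≤ C / ((n : ℝ) + 1) := by positivity
    refine (norm_add_le _ _).trans (add_le_add
      ((abs_integral_logCutoff_mul_le (hK t) (fun x hx => hsK x hx t) n).trans (hk t)) ?_)
    rw [Real.norm_of_nonneg (by positivity)]
    gcongr
  · simpa using (tendsto_integral_logCutoff_mul hs (hK t) fun x hx => hsK x hx t).add hCn

end Balance

section Divergence

open Set Topology

variable {d : ℕ} {G g : ℝ → ℝ} {U : EuclideanSpace ℝ (Fin d) × ℝ → ℝ}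
  {x : EuclideanSpace ℝ (Fin d)} {R : ℝ}

/-- The function `x ↦ R / √(R² + |x|²)` on space-time. -/
noncomputable def spaceWeight {d : ℕ} (R : ℝ) (q : EuclideanSpace ℝ (Fin d) × ℝ) : ℝ :=
  radialWeight R q.1

lemma contDiff_spaceWeight (hR : 0 < R) :
    ContDiff ℝ 1 (spaceWeight R : EuclideanSpace ℝ (Fin d) × ℝ → ℝ) :=
  (contDiff_radialWeight hR).comp contDiff_fst

lemma hasLineDerivAt_spaceWeight (hR : 0 < R) (x : EuclideanSpace ℝ (Fin d)) (t : ℝ) (i : Fin d) :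
    HasLineDerivAt ℝ (spaceWeight R) (-((R ^ 2)⁻¹ * radialWeight R x ^ 3) * x i) (x, t)
      (EuclideanSpace.single i 1, 0) :=
  hasLineDerivAt_fst (hasFDerivAt_radialWeight hR x) t i

lemma hasLineDerivAt_spaceWeight_time (x : EuclideanSpace ℝ (Fin d)) (t : ℝ) :
    HasLineDerivAt ℝ (spaceWeight R) 0 (x, t) ((0 : EuclideanSpace ℝ (Fin d)), (1 : ℝ)) :=
  hasLineDerivAt_fst_time _ _

lemma sum_fderiv_hardyFlux (hR : 0 < R) (hU : ContDiffOn ℝ 1 U (puncturedSpaceTime d))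
    (hx : x ≠ 0) (t : ℝ) :
    ∑ i, fderiv ℝ (fun q => -(spaceWeight R q ^ 2 * q.1 i * U q ^ 2)) (x, t)
        (EuclideanSpace.single i 1, 0)
      = -(((d : ℝ) - 2) * radialWeight R x ^ 2 * U (x, t) ^ 2
        + 2 * radialWeight R x ^ 4 * U (x, t) ^ 2
        + 2 * radialWeight R x ^ 2 * U (x, t) * eulerDeriv U (x, t)) := by
  have hi : ∀ i : Fin d, fderiv ℝ (fun q => -(spaceWeight R q ^ 2 * q.1 i * U q ^ 2)) (x, t)
      (EuclideanSpace.single i 1, 0)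
      = -(radialWeight R x ^ 2 * U (x, t) ^ 2)
        + 2 * (R ^ 2)⁻¹ * radialWeight R x ^ 4 * U (x, t) ^ 2 * (x i * x i)
        + (-2 * radialWeight R x ^ 2 * U (x, t)) * (x i * pX i U (x, t)) := by
    intro i
    have h1 := ((((hasLineDerivAt_spaceWeight hR x t i).fun_pow 2).fun_mul
      (hasLineDerivAt_coord (x, t) i i)).fun_mul
      ((hasLineDerivAt_pX one_ne_zero hU hx t i).fun_pow 2)).const_mul (-1)
    have h2 : DifferentiableAt ℝ (fun q => -1 * (spaceWeight R q ^ 2 * q.1 i * U q ^ 2))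
        (x, t) := by
      refine differentiableAt_of_contDiffOn one_ne_zero ?_ hx t
      exact contDiffOn_const.mul ((((contDiff_spaceWeight hR).pow 2).mul
        (contDiff_coord i)).contDiffOn.mul (hU.pow 2))
    have h3 := h1.fderiv_apply h2
    simp only [neg_one_mul] at h3
    rw [h3]
    simp [spaceWeight]
    ring
  rw [Finset.sum_congr rfl fun i _ => hi i]
  simp only [Finset.sum_add_distrib, ← Finset.mul_sum, sum_coord_sq, Finset.sum_const,
    Finset.card_univ, Fintype.card_fin, nsmul_eq_mul]
  have hw := radialWeight_identity hR x
  rw [eulerDeriv]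
  linear_combination (2 * radialWeight R x ^ 2 * U (x, t) ^ 2) * hw

lemma hasLineDerivAt_gradSq (hU : ContDiffOn ℝ 2 U (puncturedSpaceTime d)) (hx : x ≠ 0) (t : ℝ)
    (v : EuclideanSpace ℝ (Fin d) × ℝ) :
    HasLineDerivAt ℝ (gradSq U) (2 * ∑ j, fderiv ℝ (pX j U) (x, t) v * pX j U (x, t)) (x, t) v := by
  have h := HasLineDerivAt.fun_sum (s := Finset.univ) fun j _ =>
    ((differentiableAt_of_contDiffOn one_ne_zero (contDiffOn_pX hU j)
      hx t).hasFDerivAt.hasLineDerivAt v).fun_mul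
    ((differentiableAt_of_contDiffOn one_ne_zero (contDiffOn_pX hU j)
      hx t).hasFDerivAt.hasLineDerivAt v)
  refine HasDerivAt.congr_deriv h ?_
  rw [Finset.mul_sum]
  exact Finset.sum_congr rfl fun j _ => by ring

lemma hasLineDerivAt_eulerDeriv (hU : ContDiffOn ℝ 2 U (puncturedSpaceTime d)) (hx : x ≠ 0)
    (t : ℝ) (i : Fin d) :
    HasLineDerivAt ℝ (eulerDeriv U) (pX i U (x, t) + ∑ j, x j * pX i (pX j U) (x, t)) (x, t)
      (EuclideanSpace.single i 1, 0) := by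
  have h := HasLineDerivAt.fun_sum (s := Finset.univ) fun j _ =>
    (hasLineDerivAt_coord (x, t) i j).fun_mul
    (hasLineDerivAt_pX one_ne_zero (contDiffOn_pX hU j) hx t i)
  refine HasDerivAt.congr_deriv h ?_
  simp [Finset.sum_add_distrib]

lemma hasLineDerivAt_eulerDeriv_time (hU : ContDiffOn ℝ 2 U (puncturedSpaceTime d)) (hx : x ≠ 0)
    (t : ℝ) :
    HasLineDerivAt ℝ (eulerDeriv U) (∑ j, x j * pT (pX j U) (x, t)) (x, t) (0, 1) := by
  have h := HasLineDerivAt.fun_sum (s := Finset.univ) fun j _ =>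
    (hasLineDerivAt_fst_time (fun y => y j) (x, t)).fun_mul
    (hasLineDerivAt_pT one_ne_zero (contDiffOn_pX hU j) hx t)
  refine HasDerivAt.congr_deriv h ?_
  simp

namespace IsRegularSolution

lemma hasLineDerivAt_energyDensity_time (h : IsRegularSolution G g U) (hx : x ≠ 0) (t : ℝ) :
    HasLineDerivAt ℝ (energyDensity G U) (∑ j, pT (pX j U) (x, t) * pX j U (x, t)
      + pT U (x, t) * pT (pT U) (x, t) + U (x, t) * pT U (x, t) * ‖x‖⁻¹
      + g (U (x, t)) * pT U (x, t)) (x, t) (0, 1) := by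
  have hu := hasLineDerivAt_pT two_ne_zero h.contDiffOn hx t
  have h1 := ((((hasLineDerivAt_gradSq h.contDiffOn hx t (0, 1)).const_mul (1 / 2)).fun_add
    (((hasLineDerivAt_pT one_ne_zero (contDiffOn_pT h.contDiffOn) hx t).fun_pow 2).const_mul
      (1 / 2))).fun_add (((hu.fun_pow 2).fun_mul
      (hasLineDerivAt_fst_time (fun y => ‖y‖⁻¹) (x, t))).const_mul (1 / 2))).fun_add
    (hu.scomp (h.hasDerivAt _))
  refine HasDerivAt.congr_deriv h1 ?_
  simp [pT]
  ring

lemma energy_balance (h : IsRegularSolution G g U) (hR : 0 < R) (hx : x ≠ 0) (t c : ℝ) :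
    fderiv ℝ (fun q => c * (1 - spaceWeight R q ^ 3) * energyDensity G U q) (x, t) (0, 1)
      + ∑ i, fderiv ℝ (fun q => -c * (1 - spaceWeight R q ^ 3) * pT U q * pX i U q) (x, t)
        (EuclideanSpace.single i 1, 0)
      = -c * (3 * (R ^ 2)⁻¹ * radialWeight R x ^ 5) * (pT U (x, t) * eulerDeriv U (x, t)) := by
  have hw : ∀ c : ℝ, ContDiffOn ℝ 1 (fun q : EuclideanSpace ℝ (Fin d) × ℝ =>
      c * (1 - spaceWeight R q ^ 3)) (puncturedSpaceTime d) := fun c =>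
    (contDiff_const.mul (contDiff_const.sub ((contDiff_spaceWeight hR).pow 3))).contDiffOn
  have ht : fderiv ℝ (fun q => c * (1 - spaceWeight R q ^ 3) * energyDensity G U q) (x, t) (0, 1)
      = _ :=
    ((hasLineDerivAt_fst_time (fun y => c * (1 - radialWeight R y ^ 3)) (x, t)).fun_mul
      (h.hasLineDerivAt_energyDensity_time hx t)).fderiv_apply
      (differentiableAt_of_contDiffOn one_ne_zero ((hw c).mul h.contDiffOn_energyDensity) hx t)
  have hi : ∀ i : Fin d, fderiv ℝ (fun q => -c * (1 - spaceWeight R q ^ 3) * pT U q * pX i U q)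
      (x, t) (EuclideanSpace.single i 1, 0)
      = -c * (3 * (R ^ 2)⁻¹ * radialWeight R x ^ 5) * pT U (x, t) * (x i * pX i U (x, t))
        + -c * (1 - radialWeight R x ^ 3) * (pT (pX i U) (x, t) * pX i U (x, t))
        + -c * (1 - radialWeight R x ^ 3) * pT U (x, t) * pX i (pX i U) (x, t) := by
    intro i
    have h1 := (((((hasLineDerivAt_spaceWeight hR x t i).fun_pow 3).const_mul c).fun_add
      (show HasLineDerivAt ℝ (fun _ => -c) 0 (x, t) _ from hasDerivAt_const (0 : ℝ) (-c))).fun_mul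
      (hasLineDerivAt_pX one_ne_zero (contDiffOn_pT h.contDiffOn) hx t i)).fun_mul
      (hasLineDerivAt_pX one_ne_zero (contDiffOn_pX h.contDiffOn i) hx t i)
    have he : (fun q => -c * (1 - spaceWeight R q ^ 3) * pT U q * pX i U q)
        = fun q => (c * spaceWeight R q ^ 3 + -c) * pT U q * pX i U q := by
      funext q; ring
    have h2 := differentiableAt_of_contDiffOn one_ne_zero (((hw (-c)).mul
      (contDiffOn_pT h.contDiffOn)).mul (contDiffOn_pX h.contDiffOn i)) hx t
    rw [he] at h2 ⊢
    rw [h1.fderiv_apply h2, pX_pT_comm h.contDiffOn hx]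
    simp [spaceWeight]
    ring
  rw [ht, Finset.sum_congr rfl fun i _ => hi i]
  simp only [Finset.sum_add_distrib, ← Finset.mul_sum]
  rw [eulerDeriv]
  linear_combination (c * (1 - radialWeight R x ^ 3) * pT U (x, t)) * h.equation x hx t

end IsRegularSolution

end Divergence

section Morawetz

open Set Topology

variable {d : ℕ} {G g : ℝ → ℝ} {U : EuclideanSpace ℝ (Fin d) × ℝ → ℝ}
  {x : EuclideanSpace ℝ (Fin d)} {R : ℝ}

/-- The Morawetz multiplier `f x·∇U + ½ (d - 1) f U + ¼ f³ U` for the weight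
`f = R / √(R² + |x|²)`. -/
noncomputable def morawetzMultiplier {d : ℕ} (R : ℝ) (U : EuclideanSpace ℝ (Fin d) × ℝ → ℝ)
    (q : EuclideanSpace ℝ (Fin d) × ℝ) : ℝ :=
  spaceWeight R q * eulerDeriv U q
    + (((d : ℝ) - 1) / 2 * spaceWeight R q + 1 / 4 * spaceWeight R q ^ 3) * U q

/-- The radial part of the flux of the Morawetz identity. -/
noncomputable def morawetzFlux {d : ℕ} (R : ℝ) (G : ℝ → ℝ) (U : EuclideanSpace ℝ (Fin d) × ℝ → ℝ)
    (q : EuclideanSpace ℝ (Fin d) × ℝ) : ℝ :=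
  spaceWeight R q *
      (1 / 2 * gradSq U q - 1 / 2 * pT U q ^ 2 + 1 / 2 * (U q ^ 2 * ‖q.1‖⁻¹) + G (U q))
    - 1 / 2 * (R ^ 2)⁻¹ * ((((d : ℝ) - 1) / 2 * spaceWeight R q ^ 3 + 3 / 4 * spaceWeight R q ^ 5)
      * U q ^ 2)

namespace IsRegularSolution

lemma contDiffOn_morawetzMultiplier (h : IsRegularSolution G g U) (hR : 0 < R) :
    ContDiffOn ℝ 1 (morawetzMultiplier R U) (puncturedSpaceTime d) := by
  have hf := (contDiff_spaceWeight (d := d) hR).contDiffOn (s := puncturedSpaceTime d)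
  exact (hf.mul (contDiffOn_eulerDeriv h.contDiffOn)).add
    (((contDiffOn_const.mul hf).add (contDiffOn_const.mul (hf.pow 3))).mul h.contDiffOn_one)

lemma contDiffOn_morawetzFlux (h : IsRegularSolution G g U) (hR : 0 < R) :
    ContDiffOn ℝ 1 (morawetzFlux R G U) (puncturedSpaceTime d) := by
  have hf := (contDiff_spaceWeight (d := d) hR).contDiffOn (s := puncturedSpaceTime d)
  exact (hf.mul ((((contDiffOn_const.mul (contDiffOn_gradSq h.contDiffOn)).sub
    (contDiffOn_const.mul ((contDiffOn_pT h.contDiffOn).pow 2))).add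
    (contDiffOn_const.mul ((h.contDiffOn_one.pow 2).mul contDiffOn_norm_inv))).add
    h.contDiffOn_potential)).sub (contDiffOn_const.mul
    (((contDiffOn_const.mul (hf.pow 3)).add (contDiffOn_const.mul (hf.pow 5))).mul
      (h.contDiffOn_one.pow 2)))

lemma pT_morawetzMultiplier (h : IsRegularSolution G g U) (hR : 0 < R) (hx : x ≠ 0) (t : ℝ) :
    fderiv ℝ (morawetzMultiplier R U) (x, t) (0, 1)
      = radialWeight R x * ∑ j, x j * pT (pX j U) (x, t)
        + (((d : ℝ) - 1) / 2 * radialWeight R x + 1 / 4 * radialWeight R x ^ 3) * pT U (x, t) := by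
  have h1 := ((hasLineDerivAt_spaceWeight_time (R := R) x t).fun_mul
    (hasLineDerivAt_eulerDeriv_time h.contDiffOn hx t)).fun_add
    ((hasLineDerivAt_fst_time (fun y => ((d : ℝ) - 1) / 2 * radialWeight R y
      + 1 / 4 * radialWeight R y ^ 3) (x, t)).fun_mul
    (hasLineDerivAt_pT one_ne_zero h.contDiffOn_one hx t))
  refine (h1.fderiv_apply (differentiableAt_of_contDiffOn one_ne_zero
    (h.contDiffOn_morawetzMultiplier hR) hx t)).trans ?_
  simp [spaceWeight]

lemma pX_morawetzMultiplier (h : IsRegularSolution G g U) (hR : 0 < R) (hx : x ≠ 0) (t : ℝ)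
    (i : Fin d) :
    pX i (morawetzMultiplier R U) (x, t)
      = (-((R ^ 2)⁻¹ * radialWeight R x ^ 3 * eulerDeriv U (x, t))
          - (R ^ 2)⁻¹ * (((d : ℝ) - 1) / 2 * radialWeight R x ^ 3
            + 3 / 4 * radialWeight R x ^ 5) * U (x, t)) * x i
        + (((d : ℝ) + 1) / 2 * radialWeight R x + 1 / 4 * radialWeight R x ^ 3) * pX i U (x, t)
        + radialWeight R x * ∑ j, x j * pX i (pX j U) (x, t) := by
  have hf := hasLineDerivAt_spaceWeight hR x t i
  have h1 := (hf.fun_mul (hasLineDerivAt_eulerDeriv h.contDiffOn hx t i)).fun_add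
    (((hf.const_mul (((d : ℝ) - 1) / 2)).fun_add ((hf.fun_pow 3).const_mul (1 / 4))).fun_mul
      (hasLineDerivAt_pX one_ne_zero h.contDiffOn_one hx t i))
  refine (h1.fderiv_apply (differentiableAt_of_contDiffOn one_ne_zero
    (h.contDiffOn_morawetzMultiplier hR) hx t)).trans ?_
  simp [spaceWeight]
  ring

lemma pX_morawetzFlux (h : IsRegularSolution G g U) (hR : 0 < R) (hx : x ≠ 0) (t : ℝ)
    (i : Fin d) :
    pX i (morawetzFlux R G U) (x, t)
      = (-((R ^ 2)⁻¹ * radialWeight R x ^ 3 * (1 / 2 * gradSq U (x, t) - 1 / 2 * pT U (x, t) ^ 2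
            + 1 / 2 * (U (x, t) ^ 2 * ‖x‖⁻¹) + G (U (x, t))))
          - 1 / 2 * radialWeight R x * U (x, t) ^ 2 * ‖x‖⁻¹ ^ 3
          + 1 / 2 * U (x, t) ^ 2 * (R ^ 2)⁻¹ ^ 2 * radialWeight R x ^ 3
            * (3 * (((d : ℝ) - 1) / 2) * radialWeight R x ^ 2
              + 15 / 4 * radialWeight R x ^ 4)) * x i
        + (radialWeight R x * (U (x, t) * ‖x‖⁻¹ + g (U (x, t)))
          - (R ^ 2)⁻¹ * (((d : ℝ) - 1) / 2 * radialWeight R x ^ 3 + 3 / 4 * radialWeight R x ^ 5)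
            * U (x, t)) * pX i U (x, t)
        + radialWeight R x * ∑ j, pX i (pX j U) (x, t) * pX j U (x, t)
        - radialWeight R x * pT U (x, t) * pT (pX i U) (x, t) := by
  have hf := hasLineDerivAt_spaceWeight hR x t i
  have hu := hasLineDerivAt_pX one_ne_zero h.contDiffOn_one hx t i
  have h1 := (hf.fun_mul (((((hasLineDerivAt_gradSq h.contDiffOn hx t
      (EuclideanSpace.single i 1, 0)).const_mul (1 / 2)).fun_sub
    (((hasLineDerivAt_pX one_ne_zero (contDiffOn_pT h.contDiffOn) hx t i).fun_pow 2).const_mul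
      (1 / 2))).fun_add (((hu.fun_pow 2).fun_mul
      (hasLineDerivAt_fst (hasFDerivAt_norm_inv hx) t i)).const_mul (1 / 2))).fun_add
    (hu.scomp (h.hasDerivAt _)))).fun_sub
    ((((((hf.fun_pow 3).const_mul (((d : ℝ) - 1) / 2)).fun_add
      ((hf.fun_pow 5).const_mul (3 / 4))).fun_mul (hu.fun_pow 2))).const_mul (1 / 2 * (R ^ 2)⁻¹))
  refine (h1.fderiv_apply (differentiableAt_of_contDiffOn one_ne_zero
    (h.contDiffOn_morawetzFlux hR) hx t)).trans ?_
  rw [pX_pT_comm h.contDiffOn hx]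
  simp only [spaceWeight, pX, Nat.cast_ofNat, Nat.add_one_sub_one, pow_one]
  ring

lemma morawetz_identity (h : IsRegularSolution G g U) {κ : ℝ}
    (hg : ∀ s, s * g s = κ * G s) (hR : 0 < R) (hx : x ≠ 0) (t : ℝ) :
    fderiv ℝ (fun q => pT U q * morawetzMultiplier R U q) (x, t) (0, 1)
      + ∑ i, fderiv ℝ (fun q => morawetzFlux R G U q * q.1 i - morawetzMultiplier R U q * pX i U q)
        (x, t) (EuclideanSpace.single i 1, 0)
      = -(1 / 4 * radialWeight R x ^ 3 * pT U (x, t) ^ 2 + radialWeight R x * gradSq U (x, t)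
        - (R ^ 2)⁻¹ * radialWeight R x ^ 3 * eulerDeriv U (x, t) ^ 2
        - 1 / 4 * radialWeight R x ^ 3 * gradSq U (x, t)
        + 1 / 2 * (R ^ 2)⁻¹ * (((d : ℝ) - 3) * (((d : ℝ) - 1) / 2) * radialWeight R x ^ 3
          + (3 / 4 * d + 3 * (((d : ℝ) - 1) / 2) - 15 / 4) * radialWeight R x ^ 5
          + 15 / 4 * radialWeight R x ^ 7) * U (x, t) ^ 2
        + (1 / 2 * radialWeight R x - 1 / 4 * radialWeight R x ^ 3) * (U (x, t) ^ 2 * ‖x‖⁻¹)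
        + ((κ - 2) * (((d : ℝ) - 1) / 2) * radialWeight R x
          + (κ / 4 - 1) * radialWeight R x ^ 3) * G (U (x, t))) := by
  have hm := h.contDiffOn_morawetzMultiplier hR
  have hΦ := h.contDiffOn_morawetzFlux hR
  have ht : fderiv ℝ (fun q => pT U q * morawetzMultiplier R U q) (x, t) (0, 1) = _ :=
    ((hasLineDerivAt_pT one_ne_zero (contDiffOn_pT h.contDiffOn) hx t).fun_mul
      (hasLineDerivAt_pT one_ne_zero hm hx t)).fderiv_apply
      (differentiableAt_of_contDiffOn one_ne_zero ((contDiffOn_pT h.contDiffOn).mul hm) hx t)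
  have hi : ∀ i : Fin d, fderiv ℝ (fun q => morawetzFlux R G U q * q.1 i
      - morawetzMultiplier R U q * pX i U q) (x, t) (EuclideanSpace.single i 1, 0)
      = pX i (morawetzFlux R G U) (x, t) * x i + morawetzFlux R G U (x, t)
        - (pX i (morawetzMultiplier R U) (x, t) * pX i U (x, t)
          + morawetzMultiplier R U (x, t) * pX i (pX i U) (x, t)) := by
    intro i
    have h1 := ((hasLineDerivAt_pX one_ne_zero hΦ hx t i).fun_mul
      (hasLineDerivAt_coord (x, t) i i)).fun_sub
      ((hasLineDerivAt_pX one_ne_zero hm hx t i).fun_mul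
      (hasLineDerivAt_pX one_ne_zero (contDiffOn_pX h.contDiffOn i) hx t i))
    refine (h1.fderiv_apply (differentiableAt_of_contDiffOn one_ne_zero
      ((hΦ.mul (contDiff_coord i).contDiffOn).sub
        (hm.mul (contDiffOn_pX h.contDiffOn i))) hx t)).trans ?_
    simp
  have hsymm : ∑ i, (∑ j, x j * pX i (pX j U) (x, t)) * pX i U (x, t)
      = ∑ i, (∑ j, pX i (pX j U) (x, t) * pX j U (x, t)) * x i := by
    simp only [Finset.sum_mul]
    rw [Finset.sum_comm]
    refine Finset.sum_congr rfl fun i _ => Finset.sum_congr rfl fun j _ => ?_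
    rw [pX_pX_comm h.contDiffOn hx]
    ring
  have hW : ∑ i, pT (pX i U) (x, t) * x i = ∑ i, x i * pT (pX i U) (x, t) :=
    Finset.sum_congr rfl fun i _ => mul_comm _ _
  have hY : ∑ i, pX i U (x, t) * x i = eulerDeriv U (x, t) :=
    Finset.sum_congr rfl fun i _ => mul_comm _ _
  have hY' : ∑ i, x i * pX i U (x, t) = eulerDeriv U (x, t) := rfl
  have hn : ∑ i, pX i U (x, t) * pX i U (x, t) = gradSq U (x, t) := rfl
  have hmt : pT (morawetzMultiplier R U) (x, t) = _ := h.pT_morawetzMultiplier hR hx t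
  rw [ht, Finset.sum_congr rfl fun i _ => hi i, hmt]
  simp only [h.pX_morawetzMultiplier hR hx, h.pX_morawetzFlux hR hx, add_mul (_ + _),
    sub_mul (_ + _),
    add_mul (_ * _), mul_assoc _ (x _) (x _), mul_assoc _ (x _) (pX _ _ _),
    mul_assoc _ (pX _ _ _) (x _), mul_assoc _ (pX _ _ _) (pX _ _ _),
    mul_assoc _ (pT _ _) (x _), mul_assoc _ (Finset.sum _ _) (x _),
    mul_assoc _ (Finset.sum _ _) (pX _ _ _),
    Finset.sum_add_distrib, Finset.sum_sub_distrib,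
    ← Finset.mul_sum, sum_coord_sq, Finset.sum_const, Finset.card_univ, Fintype.card_fin,
    nsmul_eq_mul, hsymm, hW, hY, hY', hn]
  have hw := radialWeight_identity hR x
  have hρ : ‖x‖⁻¹ ^ 2 * ‖x‖ ^ 2 = 1 := by
    rw [← mul_pow, inv_mul_cancel₀ (norm_ne_zero_iff.2 hx), one_pow]
  simp only [morawetzMultiplier, morawetzFlux, spaceWeight]
  linear_combination (radialWeight R x * eulerDeriv U (x, t)
      + (((d : ℝ) - 1) / 2 * radialWeight R x + 1 / 4 * radialWeight R x ^ 3) * U (x, t))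
        * h.equation x hx t
    - (((d : ℝ) - 1) / 2 * radialWeight R x + 1 / 4 * radialWeight R x ^ 3) * hg (U (x, t))
    - 1 / 2 * radialWeight R x * U (x, t) ^ 2 * ‖x‖⁻¹ * hρ
    + (1 / 2 * U (x, t) ^ 2 * (R ^ 2)⁻¹ * radialWeight R x ^ 3
        * (3 * (((d : ℝ) - 1) / 2) + 15 / 4 * radialWeight R x ^ 2)
      - radialWeight R x * (1 / 2 * gradSq U (x, t) - 1 / 2 * pT U (x, t) ^ 2
        + 1 / 2 * (U (x, t) ^ 2 * ‖x‖⁻¹) + G (U (x, t)))) * hw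

end IsRegularSolution

end Morawetz

section Bounds

variable {V : Type*} [NormedAddCommGroup V] {R : ℝ}

lemma radialWeight_mul_norm_le (hR : 0 < R) (x : V) : radialWeight R x * ‖x‖ ≤ R := by
  refine le_of_sq_le_sq ?_ hR.le
  nlinarith [radialWeight_sq_mul hR x, sq_nonneg (radialWeight R x * R)]

lemma inv_sq_mul_radialWeight_sq_mul_norm_le (hR : 0 < R) (x : V) :
    (R ^ 2)⁻¹ * radialWeight R x ^ 2 * ‖x‖ ≤ 1 / R := by
  have h1 := radialWeight_mul_norm_le hR x
  have h2 := radialWeight_le_one hR x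
  have h3 := radialWeight_pos hR x
  calc (R ^ 2)⁻¹ * radialWeight R x ^ 2 * ‖x‖
      = (R ^ 2)⁻¹ * (radialWeight R x * (radialWeight R x * ‖x‖)) := by ring
    _ ≤ (R ^ 2)⁻¹ * (1 * R) := by gcongr
    _ = 1 / R := by field_simp

lemma one_sub_radialWeight_cube_nonneg (hR : 0 < R) (x : V) : 0 ≤ 1 - radialWeight R x ^ 3 :=
  sub_nonneg.2 (pow_le_one₀ (radialWeight_pos hR x).le (radialWeight_le_one hR x))

lemma one_sub_radialWeight_cube_le (hR : 0 < R) (x : V) :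
    1 - radialWeight R x ^ 3 ≤ 3 / R * ‖x‖ := by
  have h1 := inv_sq_mul_radialWeight_sq_mul_norm_le hR x
  have h2 := radialWeight_le_one hR x
  have h3 := (radialWeight_pos hR x).le
  have h4 := radialWeight_identity hR x
  have h5 : 1 - radialWeight R x ^ 2 ≤ 1 / R * ‖x‖ := by
    rw [← h4]
    calc (R ^ 2)⁻¹ * ‖x‖ ^ 2 * radialWeight R x ^ 2
        = (R ^ 2)⁻¹ * radialWeight R x ^ 2 * ‖x‖ * ‖x‖ := by ring
      _ ≤ _ := by gcongr
  have h6 : 1 - radialWeight R x ^ 3 ≤ 3 * (1 - radialWeight R x ^ 2) := by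
    have h7 : 0 ≤ 2 + 2 * radialWeight R x - radialWeight R x ^ 2 := by nlinarith
    linarith [mul_nonneg (sub_nonneg.2 h2) h7]
  calc _ ≤ _ := h6
    _ ≤ 3 * (1 / R * ‖x‖) := by gcongr
    _ = _ := by ring

end Bounds

section PointwiseEstimates

open Set Topology

variable {d : ℕ} {G g : ℝ → ℝ} {U : EuclideanSpace ℝ (Fin d) × ℝ → ℝ}
  {x : EuclideanSpace ℝ (Fin d)} {R : ℝ}

lemma abs_pT_mul_eulerDeriv_le (q : EuclideanSpace ℝ (Fin d) × ℝ) :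
    |pT U q * eulerDeriv U q| ≤ ‖q.1‖ * (1 / 2 * gradSq U q + 1 / 2 * pT U q ^ 2) := by
  have h1 := eulerDeriv_sq_le (U := U) q
  have h2 := gradSq_nonneg (U := U) q
  have h3 := norm_nonneg q.1
  refine abs_le_of_sq_le_sq ?_ (by positivity)
  calc (pT U q * eulerDeriv U q) ^ 2 = pT U q ^ 2 * eulerDeriv U q ^ 2 := by ring
    _ ≤ pT U q ^ 2 * (‖q.1‖ ^ 2 * gradSq U q) := by gcongr
    _ ≤ _ := by nlinarith [mul_nonneg (sq_nonneg ‖q.1‖) (sq_nonneg (gradSq U q - pT U q ^ 2))]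

/-- The density `|U|²/|x|²` of Hardy's inequality. -/
noncomputable def hardyDensity {d : ℕ} (U : EuclideanSpace ℝ (Fin d) × ℝ → ℝ)
    (q : EuclideanSpace ℝ (Fin d) × ℝ) : ℝ := U q ^ 2 * ‖q.1‖⁻¹ ^ 2

lemma hardyDensity_nonneg (q : EuclideanSpace ℝ (Fin d) × ℝ) : 0 ≤ hardyDensity U q := by
  unfold hardyDensity; positivity

lemma norm_sq_mul_hardyDensity (hx : x ≠ 0) (t : ℝ) :
    ‖x‖ ^ 2 * hardyDensity U (x, t) = U (x, t) ^ 2 := by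
  have : ‖x‖ ≠ 0 := norm_ne_zero_iff.2 hx
  simp only [hardyDensity]
  field_simp

lemma hardy_le (hd : 3 ≤ d) (hR : 0 < R) (hU : ContDiffOn ℝ 1 U (puncturedSpaceTime d))
    (hx : x ≠ 0) (t : ℝ) :
    ∑ i, fderiv ℝ (fun q => -(spaceWeight R q ^ 2 * q.1 i * U q ^ 2)) (x, t)
        (EuclideanSpace.single i 1, 0)
      ≤ 2 * R ^ 2 * gradSq U (x, t) - 1 / 2 * (radialWeight R x ^ 2 * U (x, t) ^ 2) := by
  have hd' : (3 : ℝ) ≤ d := by exact_mod_cast hd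
  have hf := radialWeight_pos hR x
  have h1 := eulerDeriv_sq_le (U := U) (x, t)
  have h2 := gradSq_nonneg (U := U) (x, t)
  have h3 : radialWeight R x ^ 2 * eulerDeriv U (x, t) ^ 2 ≤ R ^ 2 * gradSq U (x, t) := by
    calc _ ≤ radialWeight R x ^ 2 * (‖x‖ ^ 2 * gradSq U (x, t)) := by gcongr
      _ = (radialWeight R x * ‖x‖) ^ 2 * gradSq U (x, t) := by ring
      _ ≤ _ := by gcongr; exact radialWeight_mul_norm_le hR x
  rw [sum_fderiv_hardyFlux hR hU hx t]
  have h4 : 0 ≤ radialWeight R x ^ 2 * (2 * eulerDeriv U (x, t) + U (x, t)) ^ 2 := by positivity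
  have h5 : 0 ≤ ((d : ℝ) - 3) * (radialWeight R x ^ 2 * U (x, t) ^ 2) :=
    mul_nonneg (by linarith) (by positivity)
  have h6 : 0 ≤ radialWeight R x ^ 4 * U (x, t) ^ 2 := by positivity
  nlinarith

namespace IsRegularSolution

lemma kinetic_le (h : IsRegularSolution G g U) (q : EuclideanSpace ℝ (Fin d) × ℝ) :
    1 / 2 * gradSq U q + 1 / 2 * pT U q ^ 2 ≤ energyDensity G U q := by
  have h2 := h.nonneg (U q)
  have h3 : 0 ≤ U q ^ 2 * ‖q.1‖⁻¹ := by positivity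
  unfold energyDensity
  linarith

lemma abs_pT_mul_eulerDeriv_le (h : IsRegularSolution G g U)
    (q : EuclideanSpace ℝ (Fin d) × ℝ) :
    |pT U q * eulerDeriv U q| ≤ ‖q.1‖ * energyDensity G U q :=
  (_root_.abs_pT_mul_eulerDeriv_le q).trans
    (mul_le_mul_of_nonneg_left (h.kinetic_le q) (norm_nonneg _))

lemma morawetz_le (h : IsRegularSolution G g U) {κ : ℝ} (hd : 3 ≤ d) (hκ : 2 ≤ κ)
    (hκd : 2 ≤ (κ - 2) * (((d : ℝ) - 1) / 2)) (hg : ∀ s, s * g s = κ * G s) (hR : 0 < R)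
    (hx : x ≠ 0) (t : ℝ) :
    fderiv ℝ (fun q => pT U q * morawetzMultiplier R U q) (x, t) (0, 1)
      + ∑ i, fderiv ℝ (fun q => morawetzFlux R G U q * q.1 i - morawetzMultiplier R U q * pX i U q)
        (x, t) (EuclideanSpace.single i 1, 0)
      ≤ -(1 / 2) * (radialWeight R x ^ 3 * energyDensity G U (x, t)) := by
  have hd' : (3 : ℝ) ≤ d := by exact_mod_cast hd
  rw [h.morawetz_identity hg hR hx t]
  have hf := radialWeight_pos hR x
  have hf1 := radialWeight_le_one hR x
  have hw := radialWeight_identity hR x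
  have hn := gradSq_nonneg (U := U) (x, t)
  have hG := h.nonneg (U (x, t))
  have hY := eulerDeriv_sq_le (U := U) (x, t)
  simp only [energyDensity]
  set f := radialWeight R x
  set n := gradSq U (x, t)
  set Y := eulerDeriv U (x, t)
  have hρ : 0 ≤ U (x, t) ^ 2 * ‖x‖⁻¹ := by positivity
  have hf3 : f ^ 3 ≤ f := by
    calc f ^ 3 ≤ f ^ 1 := pow_le_pow_of_le_one hf.le hf1 (by norm_num)
      _ = f := pow_one f
  have hf3' : 0 ≤ f ^ 3 := by positivity
  have h1 : (R ^ 2)⁻¹ * f ^ 3 * Y ^ 2 ≤ f * n - f ^ 3 * n := by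
    calc (R ^ 2)⁻¹ * f ^ 3 * Y ^ 2 ≤ (R ^ 2)⁻¹ * f ^ 3 * (‖x‖ ^ 2 * n) := by gcongr
      _ = f * n - f ^ 3 * n := by linear_combination f * n * hw
  have h2 : 0 ≤ 1 / 2 * (R ^ 2)⁻¹ * (((d : ℝ) - 3) * (((d : ℝ) - 1) / 2) * f ^ 3
      + (3 / 4 * d + 3 * (((d : ℝ) - 1) / 2) - 15 / 4) * f ^ 5 + 15 / 4 * f ^ 7)
      * U (x, t) ^ 2 := by
    have ha : 0 ≤ ((d : ℝ) - 3) * (((d : ℝ) - 1) / 2) :=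
      mul_nonneg (by linarith) (by linarith)
    have hb : 0 ≤ 3 / 4 * d + 3 * (((d : ℝ) - 1) / 2) - 15 / 4 := by linarith
    positivity
  have h3 : 1 / 2 * f ^ 3 * G (U (x, t)) ≤ ((κ - 2) * (((d : ℝ) - 1) / 2) * f
      + (κ / 4 - 1) * f ^ 3) * G (U (x, t)) := by
    refine mul_le_mul_of_nonneg_right ?_ hG
    nlinarith [mul_le_mul_of_nonneg_right hκd hf.le, mul_le_mul_of_nonneg_right hκ hf3']
  have h4 : 1 / 4 * f ^ 3 * (U (x, t) ^ 2 * ‖x‖⁻¹)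
      ≤ (1 / 2 * f - 1 / 4 * f ^ 3) * (U (x, t) ^ 2 * ‖x‖⁻¹) :=
    mul_le_mul_of_nonneg_right (by linarith) hρ
  have h5 : 0 ≤ f ^ 3 * n := by positivity
  linarith

lemma morawetzCoeff_nonneg (hd : 3 ≤ d) (hR : 0 < R) (x : EuclideanSpace ℝ (Fin d)) :
    0 ≤ ((d : ℝ) - 1) / 2 * radialWeight R x + 1 / 4 * radialWeight R x ^ 3 := by
  have hd' : (3 : ℝ) ≤ d := by exact_mod_cast hd
  have hf := radialWeight_pos hR x
  have : 0 ≤ ((d : ℝ) - 1) / 2 := by linarith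
  positivity

lemma morawetzCoeff_le (hR : 0 < R) (x : EuclideanSpace ℝ (Fin d)) :
    ((d : ℝ) - 1) / 2 * radialWeight R x + 1 / 4 * radialWeight R x ^ 3
      ≤ ((d : ℝ) + 1) / 2 * radialWeight R x := by
  have hf := radialWeight_pos hR x
  have hf1 := radialWeight_le_one hR x
  have hf3 : radialWeight R x ^ 3 ≤ radialWeight R x ^ 1 :=
    pow_le_pow_of_le_one hf.le hf1 (by norm_num)
  linarith

lemma abs_morawetzDensity_le (h : IsRegularSolution G g U) (hd : 3 ≤ d) (hR : 0 < R)
    (hx : x ≠ 0) (t : ℝ) :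
    |pT U (x, t) * morawetzMultiplier R U (x, t)|
      ≤ ((d : ℝ) + 1) / 2 * R * (2 * energyDensity G U (x, t) + hardyDensity U (x, t)) := by
  have hd' : (3 : ℝ) ≤ d := by exact_mod_cast hd
  have hf := radialWeight_pos hR x
  have hr : 0 < ‖x‖ := norm_pos_iff.2 hx
  have hfr := radialWeight_mul_norm_le hR x
  have hb := morawetzCoeff_nonneg hd hR x
  have hb' := morawetzCoeff_le hR x
  have hk := h.kinetic_le (x, t)
  have hn := gradSq_nonneg (U := U) (x, t)
  have he := h.energyDensity_nonneg (x, t)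
  have hp := hardyDensity_nonneg (U := U) (x, t)
  have h1 : |radialWeight R x * (pT U (x, t) * eulerDeriv U (x, t))|
      ≤ R * energyDensity G U (x, t) := by
    rw [abs_mul, abs_of_pos hf]
    calc _ ≤ radialWeight R x * (‖x‖ * energyDensity G U (x, t)) := by
          gcongr; exact h.abs_pT_mul_eulerDeriv_le (x, t)
      _ = radialWeight R x * ‖x‖ * energyDensity G U (x, t) := by ring
      _ ≤ _ := by gcongr
  have h2 : |(((d : ℝ) - 1) / 2 * radialWeight R x + 1 / 4 * radialWeight R x ^ 3)
      * (U (x, t) * pT U (x, t))|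
      ≤ ((d : ℝ) + 1) / 2 * R * (1 / 2 * hardyDensity U (x, t) + energyDensity G U (x, t)) := by
    rw [abs_mul, abs_of_nonneg hb]
    have h3 : |U (x, t) * pT U (x, t)| * ‖x‖⁻¹
        ≤ 1 / 2 * hardyDensity U (x, t) + energyDensity G U (x, t) := by
      have h4 : |U (x, t) * pT U (x, t)| * ‖x‖⁻¹ = |U (x, t) * ‖x‖⁻¹| * |pT U (x, t)| := by
        rw [abs_mul, abs_mul, abs_of_pos (inv_pos.2 hr)]; ring
      have h5 : hardyDensity U (x, t) = |U (x, t) * ‖x‖⁻¹| ^ 2 := by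
        rw [sq_abs, mul_pow]; rfl
      have h6 : |pT U (x, t)| ^ 2 = pT U (x, t) ^ 2 := sq_abs _
      rw [h4, h5]
      nlinarith [sq_nonneg (|U (x, t) * ‖x‖⁻¹| - |pT U (x, t)|)]
    calc _ ≤ ((d : ℝ) + 1) / 2 * radialWeight R x * |U (x, t) * pT U (x, t)| := by gcongr
      _ = ((d : ℝ) + 1) / 2 * (radialWeight R x * ‖x‖) * (|U (x, t) * pT U (x, t)| * ‖x‖⁻¹) := by
          field_simp
      _ ≤ _ := by gcongr
  have h3 : pT U (x, t) * morawetzMultiplier R U (x, t)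
      = radialWeight R x * (pT U (x, t) * eulerDeriv U (x, t))
        + (((d : ℝ) - 1) / 2 * radialWeight R x + 1 / 4 * radialWeight R x ^ 3)
          * (U (x, t) * pT U (x, t)) := by
    simp only [morawetzMultiplier, spaceWeight]; ring
  rw [h3]
  refine (abs_add_le _ _).trans ((add_le_add h1 h2).trans ?_)
  have h7 : R * energyDensity G U (x, t)
      ≤ ((d : ℝ) + 1) / 2 * R * energyDensity G U (x, t) := by
    refine mul_le_mul_of_nonneg_right ?_ he
    nlinarith
  have h8 : 0 ≤ ((d : ℝ) + 1) / 2 * R * hardyDensity U (x, t) := by positivity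
  linarith

lemma abs_morawetzFlux_le (h : IsRegularSolution G g U) (hd : 3 ≤ d) (hR : 0 < R)
    (hx : x ≠ 0) (t : ℝ) :
    |∑ i, x i * (morawetzFlux R G U (x, t) * x i
        - morawetzMultiplier R U (x, t) * pX i U (x, t))|
      ≤ ‖x‖ ^ 2 * (2 * ((d : ℝ) + 1) * (energyDensity G U (x, t) + hardyDensity U (x, t))) := by
  have hd' : (3 : ℝ) ≤ d := by exact_mod_cast hd
  have hsum : ∑ i, x i * (morawetzFlux R G U (x, t) * x i
        - morawetzMultiplier R U (x, t) * pX i U (x, t))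
      = ‖x‖ ^ 2 * morawetzFlux R G U (x, t)
        - morawetzMultiplier R U (x, t) * eulerDeriv U (x, t) := by
    rw [← sum_coord_sq, eulerDeriv, Finset.sum_mul, Finset.mul_sum, ← Finset.sum_sub_distrib]
    exact Finset.sum_congr rfl fun i _ => by ring
  rw [hsum]
  have hf := radialWeight_pos hR x
  have hf1 := radialWeight_le_one hR x
  have hw := radialWeight_identity hR x
  have hb := morawetzCoeff_nonneg hd hR x
  have hb' := morawetzCoeff_le hR x
  have hk := h.kinetic_le (x, t)
  have hn := gradSq_nonneg (U := U) (x, t)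
  have he := h.energyDensity_nonneg (x, t)
  have hp := norm_sq_mul_hardyDensity (U := U) hx t
  have hG := h.nonneg (U (x, t))
  have hY := eulerDeriv_sq_le (U := U) (x, t)
  have hρ : 0 ≤ U (x, t) ^ 2 * ‖x‖⁻¹ := by positivity
  have hut := sq_nonneg (pT U (x, t))
  have hr2 := sq_nonneg ‖x‖
  have hA : |1 / 2 * gradSq U (x, t) - 1 / 2 * pT U (x, t) ^ 2
      + 1 / 2 * (U (x, t) ^ 2 * ‖x‖⁻¹) + G (U (x, t))| ≤ energyDensity G U (x, t) := by
    simp only [energyDensity]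
    rw [abs_le]
    constructor <;> linarith
  have hB0 : 0 ≤ ((d : ℝ) - 1) / 2 := by linarith
  have h1 : |‖x‖ ^ 2 * morawetzFlux R G U (x, t)|
      ≤ ‖x‖ ^ 2 * energyDensity G U (x, t) + ((d : ℝ) + 1) / 4 * U (x, t) ^ 2 := by
    have h11 : ‖x‖ ^ 2 * morawetzFlux R G U (x, t)
        = radialWeight R x * (‖x‖ ^ 2 * (1 / 2 * gradSq U (x, t) - 1 / 2 * pT U (x, t) ^ 2
          + 1 / 2 * (U (x, t) ^ 2 * ‖x‖⁻¹) + G (U (x, t))))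
        - 1 / 2 * ((R ^ 2)⁻¹ * ‖x‖ ^ 2 * radialWeight R x ^ 2)
          * (((d : ℝ) - 1) / 2 * radialWeight R x
          + 3 / 4 * radialWeight R x ^ 3) * U (x, t) ^ 2 := by
      simp only [morawetzFlux, spaceWeight]; ring
    rw [h11]
    refine (abs_sub _ _).trans (add_le_add ?_ ?_)
    · rw [abs_mul, abs_mul, abs_of_pos hf, abs_of_nonneg hr2]
      exact (mul_le_of_le_one_left (by positivity) hf1).trans (by gcongr)
    · rw [abs_of_nonneg (by positivity), hw]
      refine mul_le_mul_of_nonneg_right ?_ (sq_nonneg _)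
      have hf3 : radialWeight R x ^ 3 ≤ 1 := pow_le_one₀ hf.le hf1
      have hbb : ((d : ℝ) - 1) / 2 * radialWeight R x + 3 / 4 * radialWeight R x ^ 3
          ≤ ((d : ℝ) + 1) / 2 := by nlinarith
      have hbb0 : 0 ≤ ((d : ℝ) - 1) / 2 * radialWeight R x + 3 / 4 * radialWeight R x ^ 3 := by
        positivity
      have h1f : 1 - radialWeight R x ^ 2 ≤ 1 := by linarith [sq_nonneg (radialWeight R x)]
      calc _ ≤ 1 / 2 * 1 * (((d : ℝ) + 1) / 2) := by gcongr
        _ = _ := by ring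
  have h2 : |morawetzMultiplier R U (x, t) * eulerDeriv U (x, t)|
      ≤ ‖x‖ ^ 2 * gradSq U (x, t) + ((d : ℝ) + 1) / 2 * (1 / 2 * U (x, t) ^ 2
        + 1 / 2 * (‖x‖ ^ 2 * gradSq U (x, t))) := by
    have h21 : morawetzMultiplier R U (x, t) * eulerDeriv U (x, t)
        = radialWeight R x * eulerDeriv U (x, t) ^ 2
        + (((d : ℝ) - 1) / 2 * radialWeight R x + 1 / 4 * radialWeight R x ^ 3)
          * (U (x, t) * eulerDeriv U (x, t)) := by
      simp only [morawetzMultiplier, spaceWeight]; ring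
    rw [h21]
    refine (abs_add_le _ _).trans (add_le_add ?_ ?_)
    · rw [abs_of_nonneg (by positivity)]
      exact (mul_le_of_le_one_left (by positivity) hf1).trans hY
    · rw [abs_mul, abs_of_nonneg hb]
      refine mul_le_mul (hb'.trans ?_) ?_ (abs_nonneg _) (by positivity)
      · exact mul_le_of_le_one_right (by positivity) hf1
      · refine le_trans ?_ (add_le_add_right (mul_le_mul_of_nonneg_left hY one_half_pos.le) _)
        rw [abs_mul]
        nlinarith [sq_nonneg (|U (x, t)| - |eulerDeriv U (x, t)|), sq_abs (U (x, t)),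
          sq_abs (eulerDeriv U (x, t))]
  refine (abs_sub _ _).trans ((add_le_add h1 h2).trans ?_)
  have h3 : gradSq U (x, t) ≤ 2 * energyDensity G U (x, t) := by linarith
  have h4 : ‖x‖ ^ 2 * gradSq U (x, t) ≤ 2 * (‖x‖ ^ 2 * energyDensity G U (x, t)) := by
    nlinarith
  have h5 : 0 ≤ ‖x‖ ^ 2 * energyDensity G U (x, t) := by positivity
  have h6 := sq_nonneg (U (x, t))
  rw [← hp] at h6 ⊢
  nlinarith

lemma abs_energySource_le (h : IsRegularSolution G g U) (hR : 0 < R) (t : ℝ) :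
    |3 * (R ^ 2)⁻¹ * radialWeight R x ^ 5 * (pT U (x, t) * eulerDeriv U (x, t))|
      ≤ 3 / R * (radialWeight R x ^ 3 * energyDensity G U (x, t)) := by
  have hf := radialWeight_pos hR x
  have he := h.energyDensity_nonneg (x, t)
  rw [abs_mul, abs_of_nonneg (by positivity)]
  calc _ ≤ 3 * (R ^ 2)⁻¹ * radialWeight R x ^ 5 * (‖x‖ * energyDensity G U (x, t)) := by
        gcongr; exact h.abs_pT_mul_eulerDeriv_le (x, t)
    _ = 3 * ((R ^ 2)⁻¹ * radialWeight R x ^ 2 * ‖x‖)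
        * (radialWeight R x ^ 3 * energyDensity G U (x, t)) := by ring
    _ ≤ 3 * (1 / R) * (radialWeight R x ^ 3 * energyDensity G U (x, t)) := by
        gcongr; exact inv_sq_mul_radialWeight_sq_mul_norm_le hR x
    _ = _ := by ring

lemma abs_energyFlux_le (h : IsRegularSolution G g U) (hR : 0 < R) {c : ℝ} (hc : |c| = 1)
    (t : ℝ) :
    |∑ i, x i * (-c * (1 - radialWeight R x ^ 3) * pT U (x, t) * pX i U (x, t))|
      ≤ ‖x‖ ^ 2 * (3 / R * energyDensity G U (x, t)) := by
  have hsum : ∑ i, x i * (-c * (1 - radialWeight R x ^ 3) * pT U (x, t) * pX i U (x, t))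
      = -c * ((1 - radialWeight R x ^ 3) * (pT U (x, t) * eulerDeriv U (x, t))) := by
    rw [eulerDeriv, Finset.mul_sum, Finset.mul_sum, Finset.mul_sum]
    exact Finset.sum_congr rfl fun i _ => by ring
  have he := h.energyDensity_nonneg (x, t)
  rw [hsum, abs_mul, abs_neg, hc, one_mul, abs_mul,
    abs_of_nonneg (one_sub_radialWeight_cube_nonneg hR x)]
  calc _ ≤ 3 / R * ‖x‖ * (‖x‖ * energyDensity G U (x, t)) :=
        mul_le_mul (one_sub_radialWeight_cube_le hR x) (h.abs_pT_mul_eulerDeriv_le (x, t))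
          (abs_nonneg _) (by positivity)
    _ = _ := by ring

end IsRegularSolution

end PointwiseEstimates

section Hardy

open Set Topology

lemma integrable_and_integral_le_of_tendsto {α : Type*} [MeasurableSpace α] {μ : Measure α}
    {F : ℕ → α → ℝ} {f : α → ℝ} {c : ℝ} (hF : ∀ n, Integrable (F n) μ)
    (hF0 : ∀ n, 0 ≤ᵐ[μ] F n) (hc : ∀ n, ∫ x, F n x ∂μ ≤ c)
    (hlim : ∀ᵐ x ∂μ, Tendsto (fun n => F n x) atTop (𝓝 (f x))) :
    Integrable f μ ∧ ∫ x, f x ∂μ ≤ c := by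
  have hm : AEStronglyMeasurable f μ :=
    aestronglyMeasurable_of_tendsto_ae atTop (fun n => (hF n).aestronglyMeasurable) hlim
  have hf0 : 0 ≤ᵐ[μ] f := by
    filter_upwards [hlim, ae_all_iff.2 hF0] with x hx h0
    exact ge_of_tendsto' hx h0
  have hc0 : 0 ≤ c := (integral_nonneg_of_ae (hF0 0)).trans (hc 0)
  have h1 : ∫⁻ x, ENNReal.ofReal (f x) ∂μ ≤ ENNReal.ofReal c := by
    calc ∫⁻ x, ENNReal.ofReal (f x) ∂μ
        = ∫⁻ x, liminf (fun n => ENNReal.ofReal (F n x)) atTop ∂μ := by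
          refine lintegral_congr_ae ?_
          filter_upwards [hlim] with x hx
          exact ((ENNReal.continuous_ofReal.tendsto _).comp hx).liminf_eq.symm
      _ ≤ liminf (fun n => ∫⁻ x, ENNReal.ofReal (F n x) ∂μ) atTop :=
          lintegral_liminf_le' fun n => (hF n).aestronglyMeasurable.aemeasurable.ennreal_ofReal
      _ ≤ ENNReal.ofReal c := by
          refine liminf_le_of_le (by isBoundedDefault) fun b hb => ?_
          obtain ⟨n, hn⟩ := hb.exists
          refine hn.trans ?_
          rw [← ofReal_integral_eq_lintegral_ofReal (hF n) (hF0 n)]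
          exact ENNReal.ofReal_le_ofReal (hc n)
  refine ⟨⟨hm, ?_⟩, ?_⟩
  · rw [hasFiniteIntegral_iff_ofReal hf0]
    exact h1.trans_lt ENNReal.ofReal_lt_top
  · rw [integral_eq_lintegral_of_nonneg_ae hf0 hm]
    exact ENNReal.toReal_le_of_le_ofReal hc0 h1

variable {d : ℕ} {G g : ℝ → ℝ} {U : EuclideanSpace ℝ (Fin d) × ℝ → ℝ}
  {x : EuclideanSpace ℝ (Fin d)} {t E : ℝ}

lemma contDiffOn_frozen (hU : ContDiffOn ℝ 1 U (puncturedSpaceTime d)) (t : ℝ) :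
    ContDiffOn ℝ 1 (fun q => U (q.1, t)) (puncturedSpaceTime d) :=
  hU.comp (contDiff_fst.prodMk contDiff_const).contDiffOn fun _ hq =>
    mk_mem_puncturedSpaceTime hq.1 t

lemma pX_frozen (hU : ContDiffOn ℝ 1 U (puncturedSpaceTime d)) (hx : x ≠ 0) (t s : ℝ) (i : Fin d) :
    pX i (fun q => U (q.1, t)) (x, s) = pX i U (x, t) := by
  have h1 := hasLineDerivAt_pX one_ne_zero hU hx t i
  have h2 : HasLineDerivAt ℝ (fun q => U (q.1, t)) (pX i U (x, t)) (x, s)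
      (EuclideanSpace.single i (1 : ℝ), (0 : ℝ)) := by
    simpa [HasLineDerivAt] using h1
  exact h2.fderiv_apply
    (differentiableAt_of_contDiffOn one_ne_zero (contDiffOn_frozen hU t) hx s)

namespace IsRegularSolution

lemma radialWeight_sq_mul_sq_le (h : IsRegularSolution G g U) {ε : ℝ} (hε : 0 < ε) (hx : x ≠ 0)
    (t : ℝ) : radialWeight ε x ^ 2 * U (x, t) ^ 2 ≤ 2 * ε * energyDensity G U (x, t) := by
  have hf := radialWeight_pos hε x
  have hr : 0 < ‖x‖ := norm_pos_iff.2 hx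
  have h1 : U (x, t) ^ 2 * ‖x‖⁻¹ ≤ 2 * energyDensity G U (x, t) := by
    have h2 := gradSq_nonneg (U := U) (x, t)
    have h3 := h.nonneg (U (x, t))
    have h4 := sq_nonneg (pT U (x, t))
    simp only [energyDensity]
    linarith
  calc radialWeight ε x ^ 2 * U (x, t) ^ 2
      = radialWeight ε x * (radialWeight ε x * ‖x‖) * (U (x, t) ^ 2 * ‖x‖⁻¹) := by field_simp
    _ ≤ 1 * ε * (2 * energyDensity G U (x, t)) := by
        have := radialWeight_le_one hε x
        have := radialWeight_mul_norm_le hε x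
        gcongr
    _ = _ := by ring

lemma integral_radialWeight_sq_mul_sq_le [NeZero d] (h : IsRegularSolution G g U) (hd : 3 ≤ d)
    (hi : Integrable fun x => energyDensity G U (x, t))
    (hE : ∫ x, energyDensity G U (x, t) = E) {ε : ℝ} (hε : 0 < ε) :
    Integrable (fun x => radialWeight ε x ^ 2 * U (x, t) ^ 2) ∧
      ∫ x, radialWeight ε x ^ 2 * U (x, t) ^ 2 ≤ 8 * ε ^ 2 * E := by
  have hU := contDiffOn_frozen h.contDiffOn_one t
  have hw := contDiff_spaceWeight (d := d) hε
  have hgr : ∀ x, x ≠ 0 → ∀ s, gradSq (fun q => U (q.1, t)) (x, s) = gradSq U (x, t) :=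
    fun x hx s => by simp only [gradSq, pX_frozen h.contDiffOn_one hx]
  have hgc : ContinuousOn (gradSq fun q => U (q.1, t)) (puncturedSpaceTime d) :=
    (contDiffOn_frozen (contDiffOn_gradSq h.contDiffOn) t).continuousOn.congr
      fun q hq => hgr q.1 hq.1 q.2
  have hgi : Integrable fun x => gradSq U (x, t) := by
    refine integrable_slice (contDiffOn_gradSq h.contDiffOn).continuousOn (hi.const_mul 2)
      fun x _ => ?_
    rw [abs_of_nonneg (gradSq_nonneg _)]
    linarith [h.kinetic_le (x, t), sq_nonneg (pT U (x, t))]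
  have hfi : Integrable fun x => radialWeight ε x ^ 2 * U (x, t) ^ 2 := by
    refine integrable_slice (t := t) (F := fun q => spaceWeight ε q ^ 2 * U q ^ 2)
      ((hw.pow 2).contDiffOn.mul (h.contDiffOn_one.pow 2)).continuousOn (hi.const_mul (2 * ε))
      fun x hx => ?_
    rw [abs_of_nonneg (by positivity)]
    exact h.radialWeight_sq_mul_sq_le hε hx t
  have hb := integral_sub_le_of_balance (D := fun _ => 0)
    (J := fun i q => -(spaceWeight ε q ^ 2 * q.1 i * U (q.1, t) ^ 2))
    (s := fun q => 2 * ε ^ 2 * gradSq (fun q => U (q.1, t)) q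
      - 1 / 2 * (spaceWeight ε q ^ 2 * U (q.1, t) ^ 2))
    (K := fun q => (2 * ε + 4 * ε ^ 2) * energyDensity G U (q.1, t))
    (k := (2 * ε + 4 * ε ^ 2) * E)
    contDiffOn_const
    (fun i => (((hw.pow 2).mul (contDiff_coord i)).contDiffOn.mul (hU.pow 2)).neg)
    ((continuousOn_const.mul hgc).sub
      (contDiffOn_const.mul ((hw.pow 2).contDiffOn.mul (hU.pow 2))).continuousOn)
    (fun s => hi.const_mul _)
    (fun s => by rw [integral_const_mul, hE])
    (fun x hx s => by
      have := h.energyDensity_nonneg (x, t)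
      rw [abs_zero]; positivity)
    (fun x hx s => by
      have h1 : ∑ i, x i * -(spaceWeight ε (x, s) ^ 2 * x i * U (x, t) ^ 2)
          = -(‖x‖ ^ 2 * (radialWeight ε x ^ 2 * U (x, t) ^ 2)) := by
        rw [← sum_coord_sq, Finset.sum_mul, ← Finset.sum_neg_distrib]
        exact Finset.sum_congr rfl fun i _ => by simp only [spaceWeight]; ring
      have h2 := h.radialWeight_sq_mul_sq_le hε hx t
      have h3 := h.energyDensity_nonneg (x, t)
      have h4 : 0 ≤ ε ^ 2 * energyDensity G U (x, t) := by positivity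
      rw [h1, abs_neg, abs_of_nonneg (by positivity)]
      refine mul_le_mul_of_nonneg_left ?_ (by positivity)
      linarith)
    (fun x hx s => by
      have h2 := h.radialWeight_sq_mul_sq_le hε hx t
      have h3 := h.energyDensity_nonneg (x, t)
      have h4 := gradSq_nonneg (U := U) (x, t)
      have h5 : ε ^ 2 * gradSq U (x, t) ≤ ε ^ 2 * (2 * energyDensity G U (x, t)) := by
        gcongr
        linarith [h.kinetic_le (x, t), sq_nonneg (pT U (x, t))]
      have h6 : 0 ≤ ε ^ 2 * gradSq U (x, t) := by positivity
      have h7 : 0 ≤ radialWeight ε x ^ 2 * U (x, t) ^ 2 := by positivity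
      have h8 : 0 ≤ ε ^ 2 * energyDensity G U (x, t) := by positivity
      simp only [hgr x hx, spaceWeight]
      rw [abs_le]
      constructor <;> linarith)
    (fun x hx s => by
      refine le_trans (le_of_eq ?_) (hardy_le hd hε hU hx s)
      rw [fderiv_fun_const]
      simp)
    (zero_le_one (α := ℝ))
  have hs : ∀ s : ℝ, ∫ x, (2 * ε ^ 2 * gradSq (fun q => U (q.1, t)) (x, s)
      - 1 / 2 * (spaceWeight ε (x, s) ^ 2 * U (x, t) ^ 2))
      = 2 * ε ^ 2 * (∫ x, gradSq U (x, t))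
        - 1 / 2 * ∫ x, radialWeight ε x ^ 2 * U (x, t) ^ 2 := by
    intro s
    rw [← integral_const_mul, ← integral_const_mul, ← integral_sub (hgi.const_mul _)
      (hfi.const_mul _)]
    refine integral_congr_ae ?_
    filter_upwards [ae_ne_zero] with x hx
    simp only [hgr x hx, spaceWeight]
  simp only [hs, intervalIntegral.integral_const, sub_self, sub_zero, one_smul, integral_zero] at hb
  have hg2 : ∫ x, gradSq U (x, t) ≤ 2 * E := by
    rw [← hE, ← integral_const_mul]
    refine integral_mono hgi (hi.const_mul 2) fun x => ?_
    show gradSq U (x, t) ≤ 2 * energyDensity G U (x, t)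
    linarith [h.kinetic_le (x, t), sq_nonneg (pT U (x, t))]
  refine ⟨hfi, ?_⟩
  nlinarith [mul_le_mul_of_nonneg_left hg2 (sq_nonneg ε)]

/-- Hardy's inequality for a solution of finite energy. -/
lemma hardy [NeZero d] (h : IsRegularSolution G g U) (hd : 3 ≤ d)
    (hi : Integrable fun x => energyDensity G U (x, t))
    (hE : ∫ x, energyDensity G U (x, t) = E) :
    Integrable (fun x => hardyDensity U (x, t)) ∧ ∫ x, hardyDensity U (x, t) ≤ 8 * E := by
  have hε : ∀ n : ℕ, (0 : ℝ) < 1 / ((n : ℝ) + 1) := fun n => by positivity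
  refine integrable_and_integral_le_of_tendsto
    (F := fun n x => ((1 / ((n : ℝ) + 1)) ^ 2)⁻¹
      * (radialWeight (1 / ((n : ℝ) + 1)) x ^ 2 * U (x, t) ^ 2))
    (fun n => (h.integral_radialWeight_sq_mul_sq_le hd hi hE (hε n)).1.const_mul _)
    (fun n => Eventually.of_forall fun x => ?_) (fun n => ?_) ?_
  · have := hε n
    show (0 : ℝ) ≤ _
    positivity
  · have h1 := (h.integral_radialWeight_sq_mul_sq_le hd hi hE (hε n)).2
    rw [integral_const_mul]
    calc _ ≤ ((1 / ((n : ℝ) + 1)) ^ 2)⁻¹ * (8 * (1 / ((n : ℝ) + 1)) ^ 2 * E) := by gcongr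
      _ = 8 * E := by field_simp
  · filter_upwards [ae_ne_zero] with x hx
    have hr : 0 < ‖x‖ := norm_pos_iff.2 hx
    have h1 : ∀ n : ℕ, ((1 / ((n : ℝ) + 1)) ^ 2)⁻¹
        * (radialWeight (1 / ((n : ℝ) + 1)) x ^ 2 * U (x, t) ^ 2)
        = ((1 / ((n : ℝ) + 1)) ^ 2 + ‖x‖ ^ 2)⁻¹ * U (x, t) ^ 2 := by
      intro n
      have h2 := radialWeight_sq_mul (hε n) x
      have h3 : 0 < (1 / ((n : ℝ) + 1)) ^ 2 + ‖x‖ ^ 2 := by positivity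
      have h4 : radialWeight (1 / ((n : ℝ) + 1)) x ^ 2
          = (1 / ((n : ℝ) + 1)) ^ 2 * ((1 / ((n : ℝ) + 1)) ^ 2 + ‖x‖ ^ 2)⁻¹ :=
        (eq_mul_inv_iff_mul_eq₀ h3.ne').2 h2
      have h5 := (pow_pos (hε n) 2).ne'
      rw [h4, mul_assoc, inv_mul_cancel_left₀ h5]
    simp only [h1]
    have h6 := (((tendsto_one_div_add_atTop_nhds_zero_nat (𝕜 := ℝ)).pow 2).add_const
      (‖x‖ ^ 2)).inv₀ (by positivity)
    convert h6.mul_const (U (x, t) ^ 2) using 2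
    simp only [hardyDensity]
    ring

end IsRegularSolution

end Hardy

section LocalEnergy

open Set Topology

variable {d : ℕ} {G g : ℝ → ℝ} {U : EuclideanSpace ℝ (Fin d) × ℝ → ℝ} {E R : ℝ}

/-- The energy at time `t`, localized to the ball of radius `R` by a smooth weight. -/
noncomputable def localEnergy (R : ℝ) (G : ℝ → ℝ) (U : EuclideanSpace ℝ (Fin d) × ℝ → ℝ)
    (t : ℝ) : ℝ :=
  ∫ x, radialWeight R x ^ 3 * energyDensity G U (x, t)

namespace IsRegularSolution

lemma continuousOn_localEnergyDensity (h : IsRegularSolution G g U) (hR : 0 < R) :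
    ContinuousOn (fun q => spaceWeight R q ^ 3 * energyDensity G U q) (puncturedSpaceTime d) :=
  ((contDiff_spaceWeight hR).pow 3).continuous.continuousOn.mul
    h.contDiffOn_energyDensity.continuousOn

lemma localEnergyDensity_nonneg (h : IsRegularSolution G g U) (hR : 0 < R)
    (q : EuclideanSpace ℝ (Fin d) × ℝ) : 0 ≤ radialWeight R q.1 ^ 3 * energyDensity G U q :=
  mul_nonneg (pow_nonneg (radialWeight_pos hR q.1).le 3) (h.energyDensity_nonneg q)

lemma localEnergyDensity_le (h : IsRegularSolution G g U) (hR : 0 < R)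
    (q : EuclideanSpace ℝ (Fin d) × ℝ) :
    radialWeight R q.1 ^ 3 * energyDensity G U q ≤ energyDensity G U q :=
  mul_le_of_le_one_left (h.energyDensity_nonneg q)
    (sub_nonneg.1 (one_sub_radialWeight_cube_nonneg hR q.1))

lemma localEnergy_nonneg (h : IsRegularSolution G g U) (hR : 0 < R) (t : ℝ) :
    0 ≤ localEnergy R G U t :=
  integral_nonneg fun x => h.localEnergyDensity_nonneg hR (x, t)

variable [NeZero d]

lemma integrable_localEnergyDensity (h : IsRegularSolution G g U) (hR : 0 < R) {t : ℝ}
    (hi : Integrable fun x => energyDensity G U (x, t)) :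
    Integrable fun x => radialWeight R x ^ 3 * energyDensity G U (x, t) :=
  integrable_slice (h.continuousOn_localEnergyDensity hR) hi fun x _ => by
    simp only [spaceWeight]
    rw [abs_of_nonneg (h.localEnergyDensity_nonneg hR (x, t))]
    exact h.localEnergyDensity_le hR (x, t)

lemma intervalIntegrable_localEnergy (h : IsRegularSolution G g U) (hR : 0 < R)
    (hi : ∀ t, Integrable fun x => energyDensity G U (x, t))
    (hE : ∀ t, ∫ x, energyDensity G U (x, t) = E) (t₁ t₂ : ℝ) :
    IntervalIntegrable (localEnergy R G U) volume t₁ t₂ :=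
  intervalIntegrable_integral (h.continuousOn_localEnergyDensity hR) hi (fun t => (hE t).le)
    (fun x _ t => by
      simp only [spaceWeight]
      rw [abs_of_nonneg (h.localEnergyDensity_nonneg hR (x, t))]
      exact h.localEnergyDensity_le hR (x, t)) t₁ t₂

/-- The local energy decreases no faster than the energy flux through the weight allows. -/
lemma localEnergy_le_add (h : IsRegularSolution G g U) (hR : 0 < R)
    (hi : ∀ t, Integrable fun x => energyDensity G U (x, t))
    (hE : ∀ t, ∫ x, energyDensity G U (x, t) = E) {t₁ t₂ : ℝ} (ht : t₁ ≤ t₂) :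
    localEnergy R G U t₁
      ≤ localEnergy R G U t₂ + 3 / R * ∫ t in t₁..t₂, localEnergy R G U t := by
  have hw := contDiff_spaceWeight (d := d) hR
  have hw1 : ContDiff ℝ 1 fun q : EuclideanSpace ℝ (Fin d) × ℝ => 1 - spaceWeight R q ^ 3 :=
    contDiff_const.sub (hw.pow 3)
  have hR3 : 0 < 3 / R := by positivity
  have hb := integral_sub_le_of_balance
    (D := fun q => 1 * (1 - spaceWeight R q ^ 3) * energyDensity G U q)
    (J := fun i q => -1 * (1 - spaceWeight R q ^ 3) * pT U q * pX i U q)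
    (s := fun q => 3 / R * (spaceWeight R q ^ 3 * energyDensity G U q))
    (K := fun q => (1 + 3 / R) * energyDensity G U q) (k := (1 + 3 / R) * E)
    ((contDiff_const.mul hw1).contDiffOn.mul h.contDiffOn_energyDensity)
    (fun i => ((contDiff_const.mul hw1).contDiffOn.mul (contDiffOn_pT h.contDiffOn)).mul
      (contDiffOn_pX h.contDiffOn i))
    (continuousOn_const.mul (h.continuousOn_localEnergyDensity hR))
    (fun s => (hi s).const_mul _)
    (fun s => by rw [integral_const_mul, hE])
    (fun x _ s => by
      have h1 := h.energyDensity_nonneg (x, s)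
      have h2 := one_sub_radialWeight_cube_nonneg hR x
      have h3 := h.localEnergyDensity_nonneg hR (x, s)
      have h4 := mul_nonneg hR3.le h1
      simp only [spaceWeight]
      rw [abs_of_nonneg (by positivity)]
      linarith)
    (fun x _ s => by
      refine (h.abs_energyFlux_le hR (c := 1) abs_one s).trans ?_
      have h1 := h.energyDensity_nonneg (x, s)
      gcongr
      linarith)
    (fun x _ s => by
      have h1 := h.energyDensity_nonneg (x, s)
      have h3 := h.localEnergyDensity_nonneg hR (x, s)
      have h4 := mul_le_mul_of_nonneg_left (h.localEnergyDensity_le hR (x, s)) hR3.le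
      simp only [spaceWeight]
      rw [abs_of_nonneg (mul_nonneg hR3.le h3)]
      linarith)
    (fun x hx s => by
      rw [h.energy_balance hR hx s 1]
      have h1 := (neg_le_abs _).trans (h.abs_energySource_le (x := x) hR s)
      simp only [spaceWeight]
      linarith)
    ht
  have hD : ∀ s, ∫ x, 1 * (1 - spaceWeight R (x, s) ^ 3) * energyDensity G U (x, s)
      = E - localEnergy R G U s := by
    intro s
    rw [localEnergy, ← hE s, ← integral_sub (hi s) (h.integrable_localEnergyDensity hR (hi s))]
    refine integral_congr_ae (Eventually.of_forall fun x => ?_)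
    simp only [spaceWeight]
    ring
  have hS : ∀ s, ∫ x, 3 / R * (spaceWeight R (x, s) ^ 3 * energyDensity G U (x, s))
      = 3 / R * localEnergy R G U s := fun s => integral_const_mul _ _
  simp only [hD, hS, intervalIntegral.integral_const_mul] at hb
  linarith

/-- The local energy at a time is controlled by its average over a subsequent interval. -/
lemma mul_localEnergy_le (h : IsRegularSolution G g U) (hR : 0 < R)
    (hi : ∀ t, Integrable fun x => energyDensity G U (x, t))
    (hE : ∀ t, ∫ x, energyDensity G U (x, t) = E) {T : ℝ} (hT : 0 < T) (hTR : T ≤ R) (t₀ : ℝ) :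
    T * localEnergy R G U t₀ ≤ 4 * ∫ t in t₀..t₀ + T, localEnergy R G U t := by
  have hloc := h.intervalIntegrable_localEnergy hR hi hE
  have hle : t₀ ≤ t₀ + T := by linarith
  set I := ∫ t in t₀..t₀ + T, localEnergy R G U t with hI
  have hI0 : 0 ≤ I := intervalIntegral.integral_nonneg hle fun t _ => h.localEnergy_nonneg hR t
  have h1 : ∀ t ∈ Icc t₀ (t₀ + T), localEnergy R G U t₀ ≤ localEnergy R G U t + 3 / R * I := by
    intro t ht
    refine (h.localEnergy_le_add hR hi hE ht.1).trans ?_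
    gcongr
    exact intervalIntegral.integral_mono_interval le_rfl ht.1 ht.2
      (Eventually.of_forall fun t => h.localEnergy_nonneg hR t) (hloc _ _)
  have h2 := intervalIntegral.integral_mono_on hle intervalIntegrable_const
    ((hloc _ _).add intervalIntegrable_const) h1
  rw [intervalIntegral.integral_add (hloc _ _) intervalIntegrable_const,
    intervalIntegral.integral_const, intervalIntegral.integral_const, add_sub_cancel_left,
    smul_eq_mul, smul_eq_mul, ← hI] at h2
  have h3 : T * (3 / R * I) ≤ 3 * I := by
    calc T * (3 / R * I) = T / R * (3 * I) := by ring
      _ ≤ 1 * (3 * I) := by gcongr; exact (div_le_one hR).2 hTR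
      _ = 3 * I := one_mul _
  linarith

/-- Integrated local energy decay. -/
lemma integral_localEnergy_le (h : IsRegularSolution G g U) {κ : ℝ} (hd : 3 ≤ d) (hκ : 2 ≤ κ)
    (hκd : 2 ≤ (κ - 2) * (((d : ℝ) - 1) / 2)) (hg : ∀ s, s * g s = κ * G s) (hR : 0 < R)
    (hi : ∀ t, Integrable fun x => energyDensity G U (x, t))
    (hE : ∀ t, ∫ x, energyDensity G U (x, t) = E) {t₁ t₂ : ℝ} (ht : t₁ ≤ t₂) :
    ∫ t in t₁..t₂, localEnergy R G U t ≤ 20 * ((d : ℝ) + 1) * R * E := by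
  have hH := fun t => h.hardy hd (hi t) (hE t)
  set D : EuclideanSpace ℝ (Fin d) × ℝ → ℝ := fun q => pT U q * morawetzMultiplier R U q with hD
  set M : ℝ := 2 * ((d : ℝ) + 1) * (1 + R) with hM
  have hM1 : 1 ≤ M := by
    have : (0 : ℝ) ≤ d := by positivity
    nlinarith
  have hMd : 2 * ((d : ℝ) + 1) ≤ M := le_mul_of_one_le_right (by positivity) (by linarith)
  have hMR : ((d : ℝ) + 1) / 2 * R * 2 ≤ M := by
    have : (0 : ℝ) ≤ d := by positivity
    nlinarith [mul_nonneg this hR.le]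
  have hDb : ∀ x, x ≠ 0 → ∀ t, |D (x, t)|
      ≤ ((d : ℝ) + 1) / 2 * R * (2 * energyDensity G U (x, t) + hardyDensity U (x, t)) :=
    fun x hx t => h.abs_morawetzDensity_le hd hR hx t
  have hDi : ∀ t, |∫ x, D (x, t)| ≤ 5 * ((d : ℝ) + 1) * R * E := by
    intro t
    have h1 := norm_integral_le_of_norm_le
      ((((hi t).const_mul 2).add (hH t).1).const_mul (((d : ℝ) + 1) / 2 * R))
      (f := fun x => D (x, t)) (by
        filter_upwards [ae_ne_zero] with x hx
        exact hDb x hx t)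
    rw [Real.norm_eq_abs, integral_const_mul] at h1
    simp only [Pi.add_apply] at h1
    rw [integral_add ((hi t).const_mul 2) (hH t).1, integral_const_mul, hE] at h1
    have h2 : ((d : ℝ) + 1) / 2 * R * (2 * E + ∫ x, hardyDensity U (x, t))
        ≤ ((d : ℝ) + 1) / 2 * R * (2 * E + 8 * E) := by
      gcongr
      exact (hH t).2
    linarith
  have hb := integral_sub_le_of_balance (D := D)
    (J := fun i q => morawetzFlux R G U q * q.1 i - morawetzMultiplier R U q * pX i U q)
    (s := fun q => -(1 / 2) * (spaceWeight R q ^ 3 * energyDensity G U q))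
    (K := fun q => M * (energyDensity G U q + hardyDensity U q)) (k := M * (9 * E))
    ((contDiffOn_pT h.contDiffOn).mul (h.contDiffOn_morawetzMultiplier hR))
    (fun i => ((h.contDiffOn_morawetzFlux hR).mul (contDiff_coord i).contDiffOn).sub
      ((h.contDiffOn_morawetzMultiplier hR).mul (contDiffOn_pX h.contDiffOn i)))
    (continuousOn_const.mul (h.continuousOn_localEnergyDensity hR))
    (fun s => ((hi s).add (hH s).1).const_mul _)
    (fun s => by
      rw [integral_const_mul, integral_add (hi s) (hH s).1, hE]
      have := (hH s).2
      gcongr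
      linarith)
    (fun x hx s => by
      have h1 := h.energyDensity_nonneg (x, s)
      have h2 := hardyDensity_nonneg (U := U) (x, s)
      calc _ ≤ _ := hDb x hx s
        _ ≤ ((d : ℝ) + 1) / 2 * R * 2 * (energyDensity G U (x, s) + hardyDensity U (x, s)) := by
          have : 0 ≤ ((d : ℝ) + 1) / 2 * R * hardyDensity U (x, s) := by positivity
          linarith
        _ ≤ _ := by gcongr)
    (fun x hx s => by
      have h1 := h.energyDensity_nonneg (x, s)
      have h2 := hardyDensity_nonneg (U := U) (x, s)
      refine (h.abs_morawetzFlux_le hd hR hx s).trans ?_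
      gcongr)
    (fun x _ s => by
      have h1 := h.energyDensity_nonneg (x, s)
      have h2 := hardyDensity_nonneg (U := U) (x, s)
      have h3 := h.localEnergyDensity_nonneg hR (x, s)
      have h4 := h.localEnergyDensity_le hR (x, s)
      have h5 : 1 * (energyDensity G U (x, s) + hardyDensity U (x, s))
          ≤ M * (energyDensity G U (x, s) + hardyDensity U (x, s)) := by gcongr
      simp only [spaceWeight] at *
      rw [abs_mul, abs_of_nonneg h3, abs_neg, abs_of_pos (by norm_num)]
      linarith)
    (fun x hx s => h.morawetz_le hd hκ hκd hg hR hx s)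
    ht
  have hS : ∀ s, ∫ x, -(1 / 2) * (spaceWeight R (x, s) ^ 3 * energyDensity G U (x, s))
      = -(1 / 2) * localEnergy R G U s := fun s => integral_const_mul _ _
  simp only [hS, intervalIntegral.integral_const_mul] at hb
  have h1 := (abs_le.1 (hDi t₁)).2
  have h2 := (abs_le.1 (hDi t₂)).1
  linarith

/-- Summed form of integrated local energy decay. -/
lemma sum_localEnergy_le (h : IsRegularSolution G g U) {κ : ℝ} (hd : 3 ≤ d) (hκ : 2 ≤ κ)
    (hκd : 2 ≤ (κ - 2) * (((d : ℝ) - 1) / 2)) (hg : ∀ s, s * g s = κ * G s)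
    (hi : ∀ t, Integrable fun x => energyDensity G U (x, t))
    (hE : ∀ t, ∫ x, energyDensity G U (x, t) = E) {T : ℝ} (hT : 0 < T) (hTR : T ≤ R)
    (t₀ : ℝ) (n : ℕ) :
    ∑ k ∈ Finset.range n, localEnergy R G U (t₀ + k * T) ≤ 80 * ((d : ℝ) + 1) * R * E / T := by
  have hR := hT.trans_le hTR
  have hloc := h.intervalIntegrable_localEnergy hR hi hE
  rw [le_div_iff₀' hT, Finset.mul_sum]
  calc ∑ k ∈ Finset.range n, T * localEnergy R G U (t₀ + k * T)
      ≤ ∑ k ∈ Finset.range n,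
          4 * ∫ t in (t₀ + (k : ℝ) * T)..(t₀ + ((k + 1 : ℕ) : ℝ) * T), localEnergy R G U t := by
        refine Finset.sum_le_sum fun k _ => ?_
        have : t₀ + ((k + 1 : ℕ) : ℝ) * T = t₀ + k * T + T := by push_cast; ring
        rw [this]
        exact h.mul_localEnergy_le hR hi hE hT hTR _
    _ = 4 * ∫ t in (t₀ + ((0 : ℕ) : ℝ) * T)..(t₀ + (n : ℝ) * T), localEnergy R G U t := by
        rw [← Finset.mul_sum, intervalIntegral.sum_integral_adjacent_intervals
          (a := fun k : ℕ => t₀ + (k : ℝ) * T) fun k _ => hloc _ _]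
    _ ≤ 4 * (20 * ((d : ℝ) + 1) * R * E) := by
        gcongr
        refine h.integral_localEnergy_le hd hκ hκd hg hR hi hE ?_
        gcongr
        positivity
    _ = _ := by ring

lemma setLIntegral_energyDensity_le (h : IsRegularSolution G g U) (hR : 0 < R) {t : ℝ}
    (hi : Integrable fun x => energyDensity G U (x, t)) :
    ∫⁻ x in {x | ‖x‖ ≤ R}, ENNReal.ofReal (energyDensity G U (x, t))
      ≤ ENNReal.ofReal (4 * localEnergy R G U t) := by
  have hm : MeasurableSet {x : EuclideanSpace ℝ (Fin d) | ‖x‖ ≤ R} :=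
    measurableSet_le measurable_norm measurable_const
  rw [localEnergy, ← integral_const_mul, ofReal_integral_eq_lintegral_ofReal
    ((h.integrable_localEnergyDensity hR hi).const_mul 4)
    (Eventually.of_forall fun x => mul_nonneg (by norm_num)
      (h.localEnergyDensity_nonneg hR (x, t)))]
  refine (setLIntegral_mono' hm fun x hx => ENNReal.ofReal_le_ofReal ?_).trans
    (setLIntegral_le_lintegral _ _)
  have h1 := mul_le_mul_of_nonneg_right (quarter_le_radialWeight_cube hR hx)
    (h.energyDensity_nonneg (x, t))
  linarith

/-- Summed local energy estimate along an arithmetic progression of times. -/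
lemma tsum_setLIntegral_energyDensity_le (h : IsRegularSolution G g U) {κ : ℝ} (hd : 3 ≤ d)
    (hκ : 2 ≤ κ) (hκd : 2 ≤ (κ - 2) * (((d : ℝ) - 1) / 2)) (hg : ∀ s, s * g s = κ * G s)
    (hi : ∀ t, Integrable fun x => energyDensity G U (x, t))
    (hE : ∀ t, ∫ x, energyDensity G U (x, t) = E) {T : ℝ} (hT : 0 < T) (hTR : T ≤ R) :
    ∑' k : ℤ, ∫⁻ x in {x | ‖x‖ ≤ R}, ENNReal.ofReal (energyDensity G U (x, (k : ℝ) * T))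
      ≤ ENNReal.ofReal (320 * ((d : ℝ) + 1) * R * E / T) := by
  have hR := hT.trans_le hTR
  refine ENNReal.summable.tsum_le_of_sum_le fun s => ?_
  obtain ⟨n, hn⟩ : ∃ n : ℕ, ∀ k ∈ s, k.natAbs ≤ n :=
    ⟨s.sup Int.natAbs, fun k hk => Finset.le_sup hk⟩
  have hs : s ⊆ (Finset.range (2 * n + 1)).image fun j : ℕ => (j : ℤ) - n := by
    intro k hk
    have := hn k hk
    exact Finset.mem_image.2 ⟨(k + n).toNat, Finset.mem_range.2 (by omega), by omega⟩
  refine (Finset.sum_le_sum_of_subset hs).trans ?_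
  rw [Finset.sum_image fun i _ j _ hij => by simpa using hij]
  calc _ ≤ ∑ j ∈ Finset.range (2 * n + 1),
        ENNReal.ofReal (4 * localEnergy R G U (-(n * T) + j * T)) := by
        refine Finset.sum_le_sum fun j _ => ?_
        have : (((j : ℤ) - n : ℤ) : ℝ) * T = -(n * T) + j * T := by push_cast; ring
        rw [this]
        exact h.setLIntegral_energyDensity_le hR (hi _)
    _ = ENNReal.ofReal (4 * ∑ j ∈ Finset.range (2 * n + 1),
          localEnergy R G U (-(n * T) + j * T)) := by
        rw [Finset.mul_sum, ENNReal.ofReal_sum_of_nonneg]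
        exact fun j _ => mul_nonneg (by norm_num) (h.localEnergy_nonneg hR _)
    _ ≤ _ := by
        refine ENNReal.ofReal_le_ofReal ?_
        have := h.sum_localEnergy_le hd hκ hκd hg hi hE hT hTR (-(n * T)) (2 * n + 1)
        calc _ ≤ 4 * (80 * ((d : ℝ) + 1) * R * E / T) := by gcongr
          _ = _ := by ring

end IsRegularSolution

end LocalEnergy

section Slices

open Set Topology

variable {d : ℕ} {x : EuclideanSpace ℝ (Fin d)} {t : ℝ}

lemma fderiv_slice {F : EuclideanSpace ℝ (Fin d) × ℝ → ℝ} (hF : DifferentiableAt ℝ F (x, t))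
    (v : EuclideanSpace ℝ (Fin d)) :
    fderiv ℝ (fun y => F (y, t)) x v = fderiv ℝ F (x, t) (v, 0) := by
  have h := (HasFDerivAt.comp x (f := fun y => (y, t)) hF.hasFDerivAt
    (hasFDerivAt_prodMk_left x t)).fderiv
  exact congrArg (fun L : EuclideanSpace ℝ (Fin d) →L[ℝ] ℝ => L v) h

lemma deriv_slice {F : EuclideanSpace ℝ (Fin d) × ℝ → ℝ} (hF : DifferentiableAt ℝ F (x, t)) :
    deriv (fun s => F (x, s)) t = pT F (x, t) :=
  (hF.hasFDerivAt.comp_hasDerivAt t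
    ((hasDerivAt_const t x).prodMk (hasDerivAt_id t))).deriv

variable {u : EuclideanSpace ℝ (Fin d) → ℝ → ℝ}

lemma norm_gradient_sq (hu : ContDiffOn ℝ 2 (fun q => u q.1 q.2) (puncturedSpaceTime d))
    (hx : x ≠ 0) (t : ℝ) :
    ‖gradient (fun y => u y t) x‖ ^ 2 = gradSq (fun q => u q.1 q.2) (x, t) := by
  rw [← sum_coord_sq, gradSq]
  have h : ∀ i, gradient (fun y => u y t) x i = pX i (fun q => u q.1 q.2) (x, t) := by
    intro i
    have h1 := fderiv_slice (differentiableAt_of_contDiffOn two_ne_zero hu hx t)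
      (EuclideanSpace.single i 1)
    rw [pX, ← h1, ← InnerProductSpace.toDual_symm_apply, EuclideanSpace.inner_single_right]
    simp [gradient]
  simp only [h]

lemma deriv_eq_pT (hu : ContDiffOn ℝ 2 (fun q => u q.1 q.2) (puncturedSpaceTime d))
    (hx : x ≠ 0) (t : ℝ) : deriv (u x) t = pT (fun q => u q.1 q.2) (x, t) :=
  deriv_slice (differentiableAt_of_contDiffOn two_ne_zero hu hx t)

lemma deriv_deriv_eq_pT (hu : ContDiffOn ℝ 2 (fun q => u q.1 q.2) (puncturedSpaceTime d))
    (hx : x ≠ 0) (t : ℝ) :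
    deriv (deriv (u x)) t = pT (pT fun q => u q.1 q.2) (x, t) := by
  rw [funext fun s => deriv_eq_pT hu hx s]
  exact deriv_slice (differentiableAt_of_contDiffOn one_ne_zero (contDiffOn_pT hu) hx t)

lemma lap_eq_sum_pX (hu : ContDiffOn ℝ 2 (fun q => u q.1 q.2) (puncturedSpaceTime d))
    (hx : x ≠ 0) (t : ℝ) :
    lap (fun y => u y t) x = ∑ i, pX i (pX i fun q => u q.1 q.2) (x, t) := by
  refine Finset.sum_congr rfl fun i _ => ?_
  have h1 : ContDiffAt ℝ 2 (fun y => u y t) x :=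
    (hu.contDiffAt (puncturedSpaceTime_mem_nhds hx t)).comp x
      (contDiffAt_id.prodMk contDiffAt_const)
  have h2 : DifferentiableAt ℝ (fderiv ℝ fun y => u y t) x :=
    (h1.fderiv_right (m := 1) (by norm_num)).differentiableAt one_ne_zero
  have h3 : (fun y => fderiv ℝ (fun y => u y t) y (EuclideanSpace.single i 1))
      =ᶠ[𝓝 x] fun y => pX i (fun q => u q.1 q.2) (y, t) := by
    filter_upwards [isOpen_compl_singleton.mem_nhds hx] with y hy
    exact fderiv_slice (differentiableAt_of_contDiffOn two_ne_zero hu hy t) _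
  have h4 : fderiv ℝ (fun y => fderiv ℝ (fun y => u y t) y (EuclideanSpace.single i 1)) x
      (EuclideanSpace.single i 1)
      = fderiv ℝ (fderiv ℝ fun y => u y t) x (EuclideanSpace.single i 1)
        (EuclideanSpace.single i 1) := by
    rw [fderiv_clm_apply h2 (differentiableAt_const _)]
    simp
  rw [iteratedFDeriv_two_apply]
  simp only [Matrix.cons_val_zero, Matrix.cons_val_one]
  rw [← h4, h3.fderiv_eq]
  exact fderiv_slice (differentiableAt_of_contDiffOn one_ne_zero (contDiffOn_pX hu i) hx t) _

end Slices

namespace IsCoulombSolution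

variable {d : ℕ} {p ζ E : ℝ} {u : EuclideanSpace ℝ (Fin d) → ℝ → ℝ}

lemma isRegularSolution (h : IsCoulombSolution p ζ u E) (hζ : 0 ≤ ζ) (hp : ζ = 0 ∨ 1 < p) :
    IsRegularSolution (fun s => ζ * |s| ^ (p + 1) / (p + 1)) (fun s => ζ * |s| ^ (p - 1) * s)
      (fun q => u q.1 q.2) where
  contDiffOn := h.2.1
  hasDerivAt s := by
    rcases hp with rfl | hp
    · simpa using hasDerivAt_const s (0 : ℝ)
    have h1 := ((hasDerivAt_abs_rpow s (p := p + 1) (by linarith)).const_mul ζ).div_const (p + 1)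
    refine h1.congr_deriv ?_
    rw [show p + 1 - 2 = p - 1 by ring]
    have : p + 1 ≠ 0 := by linarith
    field_simp
  continuous := by
    rcases hp with rfl | hp
    · simpa using continuous_const
    exact (continuous_const.mul (continuous_abs.rpow_const fun _ => Or.inr (by linarith))).mul
      continuous_id
  nonneg s := by
    rcases hp with rfl | hp
    · simp
    have : 0 < p + 1 := by linarith
    positivity
  equation x hx t := by
    have h1 := h.2.2.1 x hx t
    rwa [deriv_deriv_eq_pT h.2.1 hx, lap_eq_sum_pX h.2.1 hx, div_eq_mul_inv] at h1

lemma eDen_eq (h : IsCoulombSolution p ζ u E) {x : EuclideanSpace ℝ (Fin d)} (hx : x ≠ 0)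
    (t : ℝ) :
    eDen p ζ u x t
      = energyDensity (fun s => ζ * |s| ^ (p + 1) / (p + 1)) (fun q => u q.1 q.2) (x, t) := by
  rw [eDen, energyDensity, norm_gradient_sq h.2.1 hx, deriv_eq_pT h.2.1 hx]
  simp only [div_eq_mul_inv, mul_inv]
  ring

end IsCoulombSolution

/-- Summed local energy estimate: there is a constant `C`
depending only on `d` such that every classical finite-energy solution of the
Coulomb wave equation satisfies
`Σ_{k∈ℤ} ∫_{|x|≤R} e(x, kT) dx ≤ C·R·E/T` whenever `R ≥ T > 0`. -/
theorem stmt15 (d : ℕ) (hd : 3 ≤ d) :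
    ∃ C : ℝ, 0 < C ∧
      ∀ (p ζ : ℝ), (ζ = 0 ∨ ζ = 1) →
        (ζ = 1 →
          d ≤ 5 ∧ 1 + 4 / ((d : ℝ) - 1) ≤ p ∧ p ≤ 1 + 4 / ((d : ℝ) - 2)) →
        ∀ (u : EuclideanSpace ℝ (Fin d) → ℝ → ℝ) (E : ℝ),
          IsCoulombSolution p ζ u E →
          ∀ R T : ℝ, 0 < T → T ≤ R →
            ∑' k : ℤ,
                ∫⁻ x in {x : EuclideanSpace ℝ (Fin d) | ‖x‖ ≤ R},
                  ENNReal.ofReal (eDen p ζ u x ((k : ℝ) * T))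
              ≤ ENNReal.ofReal (C * R * E / T) := by
  have hd' : (3 : ℝ) ≤ d := by exact_mod_cast hd
  have : NeZero d := ⟨by omega⟩
  refine ⟨320 * ((d : ℝ) + 1), by positivity, fun p ζ hζ hp u E hu R T hT hTR => ?_⟩
  obtain ⟨κ, hκ, hκd, hζp, hg⟩ : ∃ κ : ℝ, 2 ≤ κ ∧ 2 ≤ (κ - 2) * (((d : ℝ) - 1) / 2) ∧
      (ζ = 0 ∨ 1 < p) ∧
      ∀ s : ℝ, s * (ζ * |s| ^ (p - 1) * s) = κ * (ζ * |s| ^ (p + 1) / (p + 1)) := by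
    rcases hζ with rfl | rfl
    · exact ⟨4, by norm_num, by linarith, Or.inl rfl, fun s => by simp⟩
    · obtain ⟨-, hp1, -⟩ := hp rfl
      have h1 : 0 < (d : ℝ) - 1 := by linarith
      have h2 : 0 < 4 / ((d : ℝ) - 1) := by positivity
      have h3 : 4 ≤ (p - 1) * ((d : ℝ) - 1) := (div_le_iff₀ h1).1 (by linarith)
      refine ⟨p + 1, by linarith, by linarith, Or.inr (by linarith), fun s => ?_⟩
      have h4 : |s| ^ (p + 1) = |s| ^ (p - 1) * (s * s) := by
        rw [show p + 1 = p - 1 + 2 by ring,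
          Real.rpow_add_of_nonneg (abs_nonneg s) (by linarith) zero_le_two, Real.rpow_two, sq_abs,
          sq]
      have h5 : p + 1 ≠ 0 := by linarith
      rw [h4]
      field_simp
  have h := hu.isRegularSolution (by rcases hζ with rfl | rfl <;> norm_num) hζp
  have hae : ∀ t, (fun x => eDen p ζ u x t) =ᵐ[volume] fun x =>
      energyDensity (fun s => ζ * |s| ^ (p + 1) / (p + 1)) (fun q => u q.1 q.2) (x, t) := by
    intro t
    filter_upwards [ae_ne_zero] with x hx using hu.eDen_eq hx t
  have hi := fun t => (hu.2.2.2.1 t).congr (hae t)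
  have hE := fun t => (integral_congr_ae (hae t)).symm.trans (hu.2.2.2.2 t)
  refine le_trans (le_of_eq ?_)
    (h.tsum_setLIntegral_energyDensity_le hd hκ hκd hg hi hE hT hTR)
  refine tsum_congr fun k => lintegral_congr_ae (ae_restrict_of_ae ?_)
  filter_upwards [hae ((k : ℝ) * T)] with x hx
  rw [hx]
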